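/- arXiv:math/0408360 — 7 statements merged into one kernel-verified Lean document; each statement's English description precedes it below -/
import Mathlib

section
/- Let p ≥ 2 be an integer, let X₁, X₂, …, Xₙ be independent random variables each uniformly distributed on the p-element set {p-1, p-3, …, 1-p}. Then there exist unique real constants a₁ > a₂ > ⋯ > aₙ > 0 such that the random variable X̃ = a₁X₁ + a₂X₂ + ⋯ + aₙXₙ satisfies E[X̃^m] = E[Y^m] for all 1 ≤ m ≤ 2n, where Y is uniform on [-1,1]; moreover these constants satisfy ∑_{j=1}^n |a_j − p^{−j}| < 1/(pⁿ(p−1)). -/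
/-- The value of `X̃ = ∑ aⱼ Xⱼ` when `Xⱼ` takes the value `p - 1 - 2·(x j)`
in the arithmetic progression `{p-1, p-3, …, 1-p}`. -/
noncomputable def Xsum (p n : ℕ) (a : Fin n → ℝ) (x : Fin n → Fin p) : ℝ :=
  ∑ j, a j * ((p : ℝ) - 1 - 2 * ((x j : ℕ) : ℝ))

/-- `X̃ = ∑ aⱼ Xⱼ` (with the `Xⱼ` independent, each uniform on
`{p-1, p-3, …, 1-p}`) matches the first `2n` moments of `Y` uniform on `[-1,1]`:
`E[X̃^m] = E[Y^m]` for `1 ≤ m ≤ 2n`, where `E[Y^m] = 1/(m+1)` for even `m` and `0`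
for odd `m`. -/
def MatchesMoments (p n : ℕ) (a : Fin n → ℝ) : Prop :=
  ∀ m : ℕ, 1 ≤ m → m ≤ 2 * n →
    (1 / (p : ℝ) ^ n) * ∑ x : Fin n → Fin p, (Xsum p n a x) ^ m
      = if Even m then 1 / ((m : ℝ) + 1) else 0

section LogDerivative

open PowerSeries

lemma coeff_X_mul_derivative (f : ℝ⟦X⟧) (m : ℕ) :
    coeff m (X * d⁄dX ℝ f) = m * coeff m f := by
  cases m with
  | zero => simp
  | succ m => rw [coeff_succ_X_mul, coeff_derivative]; push_cast; ring

/-- The logarithmic derivative of a power series, with respect to `X * d/dX`. -/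
noncomputable def eulerLogDeriv (f : ℝ⟦X⟧) : ℝ⟦X⟧ := X * d⁄dX ℝ f * f⁻¹

lemma eulerLogDeriv_mul_self {f : ℝ⟦X⟧} (hf : constantCoeff f ≠ 0) :
    eulerLogDeriv f * f = X * d⁄dX ℝ f := by
  rw [eulerLogDeriv, mul_assoc, PowerSeries.inv_mul_cancel _ hf, mul_one]

lemma eulerLogDeriv_eq {f g : ℝ⟦X⟧} (hf : constantCoeff f ≠ 0) (h : g * f = X * d⁄dX ℝ f) :
    eulerLogDeriv f = g := by
  rw [eulerLogDeriv, ← h, mul_assoc, PowerSeries.mul_inv_cancel _ hf, mul_one]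

lemma eulerLogDeriv_one : eulerLogDeriv 1 = 0 := by
  simp [eulerLogDeriv]

lemma eulerLogDeriv_mul {f g : ℝ⟦X⟧} (hf : constantCoeff f ≠ 0) (hg : constantCoeff g ≠ 0) :
    eulerLogDeriv (f * g) = eulerLogDeriv f + eulerLogDeriv g := by
  apply eulerLogDeriv_eq (by simp [hf, hg])
  have h1 := eulerLogDeriv_mul_self hf
  have h2 := eulerLogDeriv_mul_self hg
  rw [Derivation.leibniz, smul_eq_mul, smul_eq_mul]
  linear_combination g * h1 + f * h2

lemma eulerLogDeriv_rescale {f : ℝ⟦X⟧} (hf : constantCoeff f ≠ 0) (a : ℝ) :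
    eulerLogDeriv (rescale a f) = rescale a (eulerLogDeriv f) := by
  apply eulerLogDeriv_eq
  · rw [← coeff_zero_eq_constantCoeff_apply, coeff_rescale]; simpa using hf
  · rw [← map_mul, eulerLogDeriv_mul_self hf]
    ext m
    rw [coeff_rescale, coeff_X_mul_derivative, coeff_X_mul_derivative, coeff_rescale]
    ring

lemma eulerLogDeriv_prod {ι : Type*} (s : Finset ι) {f : ι → ℝ⟦X⟧}
    (hf : ∀ i, constantCoeff (f i) ≠ 0) :
    eulerLogDeriv (∏ i ∈ s, f i) = ∑ i ∈ s, eulerLogDeriv (f i) := by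
  classical
  induction s using Finset.induction_on with
  | empty => simp [eulerLogDeriv_one]
  | insert i s hi ih =>
    rw [Finset.prod_insert hi, Finset.sum_insert hi, eulerLogDeriv_mul (hf i), ih]
    rw [map_prod]
    exact Finset.prod_ne_zero_iff.2 fun j _ => hf j

lemma X_pow_dvd_iff_dvd_X_mul_derivative (f : ℝ⟦X⟧) (N : ℕ) (hf : constantCoeff f = 0) :
    X ^ N ∣ X * d⁄dX ℝ f ↔ X ^ N ∣ f := by
  simp only [X_pow_dvd_iff, coeff_X_mul_derivative, mul_eq_zero, Nat.cast_eq_zero]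
  refine forall₂_congr fun m _ => ⟨?_, Or.inr⟩
  rintro (rfl | h)
  · simpa using hf
  · exact h

lemma X_pow_dvd_sub_one_iff {f : ℝ⟦X⟧} (N : ℕ) (hf : constantCoeff f = 1) :
    X ^ N ∣ f - 1 ↔ X ^ N ∣ eulerLogDeriv f := by
  have h0 : constantCoeff f ≠ 0 := by simp [hf]
  rw [← X_pow_dvd_iff_dvd_X_mul_derivative _ _ (by simp [hf]), map_sub,
    Derivation.map_one_eq_zero, sub_zero]
  constructor
  · intro h
    exact h.mul_right _
  · intro h
    rw [← eulerLogDeriv_mul_self h0]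
    exact h.mul_right _

/-- Two power series with constant coefficient `1` agree to a given order if and only if their
logarithmic derivatives do. -/
lemma X_pow_dvd_sub_iff {f g : ℝ⟦X⟧} (N : ℕ) (hf : constantCoeff f = 1)
    (hg : constantCoeff g = 1) :
    X ^ N ∣ f - g ↔ X ^ N ∣ eulerLogDeriv f - eulerLogDeriv g := by
  have hg0 : constantCoeff g ≠ 0 := by simp [hg]
  have hi : constantCoeff g⁻¹ = 1 := by simp [hg]
  have hfg : constantCoeff (f * g⁻¹) = 1 := by simp [hf, hg]
  have hc : f * g⁻¹ * g = f := by
    rw [mul_assoc, PowerSeries.inv_mul_cancel _ hg0, mul_one]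
  have hlog : eulerLogDeriv f - eulerLogDeriv g = eulerLogDeriv (f * g⁻¹) := by
    conv_lhs => rw [← hc, eulerLogDeriv_mul (by simp [hfg]) hg0]
    ring
  rw [hlog, ← X_pow_dvd_sub_one_iff N hfg]
  constructor
  · intro h
    have : f * g⁻¹ - 1 = (f - g) * g⁻¹ := by
      rw [sub_mul, PowerSeries.mul_inv_cancel _ hg0]
    rw [this]
    exact h.mul_right _
  · intro h
    have : f - g = (f * g⁻¹ - 1) * g := by
      rw [sub_mul, hc, one_mul]
    rw [this]
    exact h.mul_right _

lemma coeff_eq_iff_eulerLogDeriv {f g : ℝ⟦X⟧} (N : ℕ) (hf : constantCoeff f = 1)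
    (hg : constantCoeff g = 1) :
    (∀ m ≤ N, coeff m f = coeff m g) ↔
      ∀ m ≤ N, coeff m (eulerLogDeriv f) = coeff m (eulerLogDeriv g) := by
  have := X_pow_dvd_sub_iff (N + 1) hf hg
  simpa only [X_pow_dvd_iff, map_sub, sub_eq_zero, Nat.lt_succ_iff] using this

end LogDerivative

section Moments

open PowerSeries

/-- The exponential moment generating series `sinh X / X` of the uniform law on `[-1, 1]`. -/
noncomputable def sinhc : ℝ⟦X⟧ :=
  mk fun m => if Even m then 1 / ((m + 1).factorial : ℝ) else 0

lemma constantCoeff_sinhc : constantCoeff sinhc = 1 := by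
  rw [← coeff_zero_eq_constantCoeff_apply, sinhc, coeff_mk]
  simp

lemma constantCoeff_rescale_sinhc (a : ℝ) : constantCoeff (rescale a sinhc) = 1 := by
  rw [← coeff_zero_eq_constantCoeff_apply, coeff_rescale]
  simp [constantCoeff_sinhc]

lemma sinhc_ode : X * d⁄dX ℝ (X * d⁄dX ℝ sinhc) = X ^ 2 * sinhc - X * d⁄dX ℝ sinhc := by
  ext m
  rw [map_sub]
  simp only [coeff_X_mul_derivative, coeff_X_pow_mul', sinhc, coeff_mk]
  match m with
  | 0 => simp
  | 1 => simp
  | m + 2 =>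
    have h1 : ((m : ℝ) + 1) ≠ 0 := by positivity
    have h2 : ((m : ℝ) + 2) ≠ 0 := by positivity
    have h3 : ((m : ℝ) + 3) ≠ 0 := by positivity
    have h4 : (((m + 1).factorial : ℕ) : ℝ) ≠ 0 := by positivity
    by_cases h : Even m
    · simp only [h, Nat.even_add, even_two, if_true, Nat.le_add_left, Nat.add_sub_cancel]
      rw [show m + 2 + 1 = m + 1 + 1 + 1 from rfl, Nat.factorial_succ (m + 1 + 1),
        Nat.factorial_succ (m + 1)]
      push_cast
      field_simp
      ring
    · simp [h, Nat.even_add]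

lemma eulerLogDeriv_sinhc_riccati :
    X * d⁄dX ℝ (eulerLogDeriv sinhc) =
      X ^ 2 - eulerLogDeriv sinhc - eulerLogDeriv sinhc ^ 2 := by
  have h0 : constantCoeff sinhc ≠ 0 := by simp [constantCoeff_sinhc]
  have hne : sinhc ≠ 0 := fun h => h0 (by simp [h])
  have h1 := eulerLogDeriv_mul_self h0
  have h2 := sinhc_ode
  rw [← h1, Derivation.leibniz, smul_eq_mul, smul_eq_mul] at h2
  apply mul_right_cancel₀ hne
  linear_combination h2 + eulerLogDeriv sinhc * h1

lemma coeff_eulerLogDeriv_sinhc_rec (m : ℕ) :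
    ((m : ℝ) + 1) * coeff m (eulerLogDeriv sinhc) = (if m = 2 then 1 else 0) -
      ∑ x ∈ Finset.HasAntidiagonal.antidiagonal m,
        coeff x.1 (eulerLogDeriv sinhc) * coeff x.2 (eulerLogDeriv sinhc) := by
  have h := congrArg (coeff m) eulerLogDeriv_sinhc_riccati
  rw [coeff_X_mul_derivative, map_sub, map_sub, sq (eulerLogDeriv sinhc), coeff_mul,
    coeff_X_pow] at h
  linarith

lemma coeff_zero_eulerLogDeriv (f : ℝ⟦X⟧) : coeff 0 (eulerLogDeriv f) = 0 := by
  simp [eulerLogDeriv]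

lemma coeff_odd_eulerLogDeriv_sinhc (m : ℕ) (hm : Odd m) :
    coeff m (eulerLogDeriv sinhc) = 0 := by
  induction m using Nat.strong_induction_on with
  | _ m ih =>
    have h := coeff_eulerLogDeriv_sinhc_rec m
    rw [if_neg (by rintro rfl; exact absurd hm (by decide)), Finset.sum_eq_zero, sub_zero] at h
    · exact (mul_eq_zero.1 h).resolve_left (by positivity)
    · rintro ⟨i, j⟩ hij
      rw [Finset.HasAntidiagonal.mem_antidiagonal] at hij
      simp only at hij ⊢
      subst hij
      rcases Nat.eq_zero_or_pos i with rfl | hi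
      · rw [coeff_zero_eulerLogDeriv, zero_mul]
      rcases Nat.eq_zero_or_pos j with rfl | hj
      · rw [coeff_zero_eulerLogDeriv, mul_zero]
      rcases Nat.even_or_odd i with he | ho
      · rw [ih j (by omega) ((Nat.odd_add'.1 hm).2 he), mul_zero]
      · rw [ih i (by omega) ho, zero_mul]

lemma coeff_even_eulerLogDeriv_sinhc_sign (k : ℕ) (hk : 1 ≤ k) :
    0 < (-1 : ℝ) ^ (k + 1) * coeff (2 * k) (eulerLogDeriv sinhc) := by
  induction k using Nat.strong_induction_on with
  | _ k ih =>
    have h := coeff_eulerLogDeriv_sinhc_rec (2 * k)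
    have hterm : ∀ x ∈ Finset.HasAntidiagonal.antidiagonal (2 * k), 0 ≤ (-1 : ℝ) ^ k *
        (coeff x.1 (eulerLogDeriv sinhc) * coeff x.2 (eulerLogDeriv sinhc)) := by
      rintro ⟨i, j⟩ hij
      rw [Finset.HasAntidiagonal.mem_antidiagonal] at hij
      simp only at hij ⊢
      rcases Nat.even_or_odd i with ⟨a, ha⟩ | ho
      · obtain ⟨b, rfl⟩ : ∃ b, j = 2 * b := ⟨k - a, by omega⟩
        obtain rfl : i = 2 * a := by omega
        rcases Nat.eq_zero_or_pos a with rfl | ha'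
        · simp [eulerLogDeriv]
        rcases Nat.eq_zero_or_pos b with rfl | hb'
        · simp [eulerLogDeriv]
        obtain rfl : k = a + b := by omega
        have h1 := ih a (by omega) ha'
        have h2 := ih b (by omega) hb'
        have h3 := mul_pos h1 h2
        rw [pow_succ, pow_succ] at h3
        rw [pow_add]
        linarith
      · rw [coeff_odd_eulerLogDeriv_sinhc i ho]; simp
    have hsum := Finset.sum_nonneg hterm
    rw [← Finset.mul_sum] at hsum
    push_cast at h
    rcases eq_or_lt_of_le hk with rfl | hk2
    · have hz : ∑ x ∈ Finset.HasAntidiagonal.antidiagonal (2 * 1),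
          coeff x.1 (eulerLogDeriv sinhc) * coeff x.2 (eulerLogDeriv sinhc) = 0 := by
        apply Finset.sum_eq_zero
        rintro ⟨i, j⟩ hij
        rw [Finset.HasAntidiagonal.mem_antidiagonal] at hij
        simp only at hij ⊢
        have : i = 0 ∨ i = 1 ∨ j = 0 := by omega
        rcases this with rfl | rfl | rfl
        · rw [coeff_zero_eulerLogDeriv, zero_mul]
        · rw [coeff_odd_eulerLogDeriv_sinhc 1 odd_one, zero_mul]
        · rw [coeff_zero_eulerLogDeriv, mul_zero]
      rw [hz] at h
      norm_num at h ⊢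
      linarith
    · rw [if_neg (by omega)] at h
      have hs := Finset.single_le_sum hterm
        (show ((2, 2 * (k - 1)) : ℕ × ℕ) ∈ Finset.HasAntidiagonal.antidiagonal (2 * k) by
          rw [Finset.HasAntidiagonal.mem_antidiagonal]; omega)
      rw [← Finset.mul_sum] at hs
      have h1 := ih 1 hk2 le_rfl
      have h2 := ih (k - 1) (by omega) (by omega)
      have h3 := mul_pos h1 h2
      rw [show k - 1 + 1 = k by omega] at h3
      have h4 : 0 < (-1 : ℝ) ^ k * ∑ x ∈ Finset.HasAntidiagonal.antidiagonal (2 * k),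
          coeff x.1 (eulerLogDeriv sinhc) * coeff x.2 (eulerLogDeriv sinhc) := by
        refine lt_of_lt_of_le ?_ hs
        simp only
        norm_num at h3
        linarith
      rw [pow_succ]
      have h6 : 0 < (2 * (k : ℝ) + 1) *
          ((-1) ^ k * -1 * coeff (2 * k) (eulerLogDeriv sinhc)) := by
        have : (2 * (k : ℝ) + 1) * ((-1) ^ k * -1 * coeff (2 * k) (eulerLogDeriv sinhc)) =
            (-1) ^ k * ∑ x ∈ Finset.HasAntidiagonal.antidiagonal (2 * k),
              coeff x.1 (eulerLogDeriv sinhc) * coeff x.2 (eulerLogDeriv sinhc) := by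
          linear_combination -(-1 : ℝ) ^ k * h
        rw [this]; exact h4
      exact pos_of_mul_pos_right h6 (by positivity)

lemma X_mul_rescale_sinhc (a : ℝ) :
    C (2 * a) * X * rescale a sinhc = rescale a (exp ℝ) - rescale (-a) (exp ℝ) := by
  ext m
  rw [map_sub, mul_assoc, coeff_C_mul]
  cases m with
  | zero => simp
  | succ m =>
    rw [coeff_succ_X_mul, coeff_rescale, coeff_rescale, coeff_rescale, sinhc, coeff_mk, coeff_exp]
    rcases Nat.even_or_odd m with h | h
    · rw [if_pos h, (h.add_one).neg_pow]
      simp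
      ring
    · rw [if_neg (Nat.not_even_iff_odd.2 h), (h.add_one).neg_pow]
      simp

lemma uniform_mul_rescale_sinhc (p : ℕ) (hp : 1 ≤ p) (a : ℝ) (ha : a ≠ 0) :
    (C (1 / (p : ℝ)) * ∑ i : Fin p, rescale (a * ((p : ℝ) - 1 - 2 * ((i : ℕ) : ℝ))) (exp ℝ))
      * rescale a sinhc = rescale (a * p) sinhc := by
  have hp0 : (p : ℝ) ≠ 0 := by positivity
  have hne : (C (2 * a) * X : ℝ⟦X⟧) ≠ 0 := by
    refine mul_ne_zero ?_ X_ne_zero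
    rw [Ne, map_eq_zero_iff _ C_injective]
    simpa using ha
  apply mul_left_cancel₀ hne
  have htel : (∑ i : Fin p, rescale (a * ((p : ℝ) - 1 - 2 * ((i : ℕ) : ℝ))) (exp ℝ)) *
      (rescale a (exp ℝ) - rescale (-a) (exp ℝ)) =
      rescale (a * p) (exp ℝ) - rescale (-(a * p)) (exp ℝ) := by
    rw [Fin.sum_univ_eq_sum_range (fun i : ℕ => rescale (a * ((p : ℝ) - 1 - 2 * (i : ℝ))) (exp ℝ)),
      Finset.sum_mul]
    have := Finset.sum_range_sub' (fun i : ℕ => rescale (a * ((p : ℝ) - 2 * (i : ℝ))) (exp ℝ)) p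
    simp only [Nat.cast_zero, mul_zero, sub_zero] at this
    rw [show -(a * (p : ℝ)) = a * ((p : ℝ) - 2 * p) by ring, ← this]
    refine Finset.sum_congr rfl fun i _ => ?_
    rw [mul_sub, exp_mul_exp_eq_exp_add, exp_mul_exp_eq_exp_add]
    push_cast
    congr 3 <;> ring
  calc _ = C (1 / (p : ℝ)) *
        (∑ i : Fin p, rescale (a * ((p : ℝ) - 1 - 2 * ((i : ℕ) : ℝ))) (exp ℝ)) *
        (C (2 * a) * X * rescale a sinhc) := by ring
    _ = C (1 / (p : ℝ)) * (C (2 * (a * p)) * X * rescale (a * p) sinhc) := by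
        rw [X_mul_rescale_sinhc, mul_assoc, htel, X_mul_rescale_sinhc]
    _ = _ := by
        have h : (2 * a : ℝ) = 1 / (p : ℝ) * (2 * (a * p)) := by field_simp
        rw [h, map_mul C (1 / (p : ℝ))]
        ring

/-- The exponential moment generating series of `∑ aⱼ Xⱼ`. -/
noncomputable def momentSeries (p n : ℕ) (a : Fin n → ℝ) : ℝ⟦X⟧ :=
  C (1 / (p : ℝ) ^ n) * ∑ x : Fin n → Fin p, rescale (Xsum p n a x) (exp ℝ)

lemma rescale_sum_exp {ι : Type*} (s : Finset ι) (f : ι → ℝ) :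
    rescale (∑ i ∈ s, f i) (exp ℝ) = ∏ i ∈ s, rescale (f i) (exp ℝ) := by
  classical
  induction s using Finset.induction_on with
  | empty => simp
  | insert i s hi ih =>
    rw [Finset.prod_insert hi, Finset.sum_insert hi, ← ih, exp_mul_exp_eq_exp_add]

lemma momentSeries_eq_prod (p n : ℕ) (a : Fin n → ℝ) :
    momentSeries p n a = ∏ j, (C (1 / (p : ℝ)) *
      ∑ i : Fin p, rescale (a j * ((p : ℝ) - 1 - 2 * ((i : ℕ) : ℝ))) (exp ℝ)) := by
  rw [Finset.prod_mul_distrib, Fintype.prod_sum, momentSeries]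
  congr 1
  · rw [Finset.prod_const, Finset.card_univ, Fintype.card_fin, ← map_pow, one_div_pow]
  · exact Finset.sum_congr rfl fun x _ => rescale_sum_exp _ _

lemma coeff_momentSeries (p n : ℕ) (a : Fin n → ℝ) (m : ℕ) :
    coeff m (momentSeries p n a) =
      (1 / (p : ℝ) ^ n) * (∑ x : Fin n → Fin p, (Xsum p n a x) ^ m) * (1 / (m.factorial : ℝ)) := by
  rw [momentSeries, coeff_C_mul, map_sum, mul_assoc, Finset.sum_mul]
  congr 1
  refine Finset.sum_congr rfl fun x _ => ?_
  rw [coeff_rescale, coeff_exp]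
  simp

lemma constantCoeff_momentSeries (p n : ℕ) (hp : 1 ≤ p) (a : Fin n → ℝ) :
    constantCoeff (momentSeries p n a) = 1 := by
  rw [← coeff_zero_eq_constantCoeff_apply, coeff_momentSeries]
  have : (p : ℝ) ≠ 0 := by positivity
  simp [this]

lemma matchesMoments_iff_coeff (p n : ℕ) (hp : 1 ≤ p) (a : Fin n → ℝ) :
    MatchesMoments p n a ↔
      ∀ m ≤ 2 * n, coeff m (momentSeries p n a) = coeff m sinhc := by
  have key : ∀ m, coeff m (momentSeries p n a) = coeff m sinhc ↔
      (1 / (p : ℝ) ^ n) * ∑ x : Fin n → Fin p, (Xsum p n a x) ^ m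
      = if Even m then 1 / ((m : ℝ) + 1) else 0 := by
    intro m
    have hm : ((m.factorial : ℕ) : ℝ) ≠ 0 := by positivity
    have hm1 : (m : ℝ) + 1 ≠ 0 := by positivity
    have : coeff m sinhc = (if Even m then 1 / ((m : ℝ) + 1) else 0) * (1 / (m.factorial : ℝ)) := by
      rw [sinhc, coeff_mk, Nat.factorial_succ]
      split_ifs
      · push_cast; field_simp
      · simp
    rw [this, coeff_momentSeries]
    exact mul_left_inj' (by positivity)
  simp only [key]
  refine ⟨fun h m hm => ?_, fun h m _ hm => h m hm⟩
  rcases Nat.eq_zero_or_pos m with rfl | h0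
  · rw [← key]
    simp [constantCoeff_sinhc, constantCoeff_momentSeries p n hp a]
  · exact h m h0 hm

lemma coeff_eulerLogDeriv_momentSeries (p n : ℕ) (hp : 1 ≤ p) (a : Fin n → ℝ)
    (ha : ∀ j, 0 < a j) (m : ℕ) :
    coeff m (eulerLogDeriv (momentSeries p n a)) =
      coeff m (eulerLogDeriv sinhc) * (((p : ℝ) ^ m - 1) * ∑ j, a j ^ m) := by
  have hs : constantCoeff sinhc ≠ 0 := by simp [constantCoeff_sinhc]
  have hprod : momentSeries p n a * ∏ j, rescale (a j) sinhc =
      ∏ j, rescale (a j * p) sinhc := by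
    rw [momentSeries_eq_prod, ← Finset.prod_mul_distrib]
    exact Finset.prod_congr rfl fun j _ => uniform_mul_rescale_sinhc p hp _ (ha j).ne'
  have h : coeff m (eulerLogDeriv (momentSeries p n a * ∏ j, rescale (a j) sinhc)) =
      coeff m (eulerLogDeriv (∏ j, rescale (a j * p) sinhc)) := by rw [hprod]
  rw [eulerLogDeriv_mul (by simp [constantCoeff_momentSeries p n hp a])
      (by rw [map_prod]; simp [constantCoeff_rescale_sinhc]),
    eulerLogDeriv_prod _ (by simp [constantCoeff_rescale_sinhc]),
    eulerLogDeriv_prod _ (by simp [constantCoeff_rescale_sinhc])] at h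
  simp only [eulerLogDeriv_rescale hs, map_add, map_sum, coeff_rescale, mul_pow,
    ← Finset.sum_mul] at h
  linear_combination h

/-- Matching the first `2n` moments amounts to prescribing the first `n` power sums of the
squares of the coefficients. -/
lemma matchesMoments_iff_power_sums (p n : ℕ) (hp : 2 ≤ p) (a : Fin n → ℝ)
    (ha : ∀ j, 0 < a j) :
    MatchesMoments p n a ↔
      ∀ k, 1 ≤ k → k ≤ n → ((p : ℝ) ^ (2 * k) - 1) * ∑ j, a j ^ (2 * k) = 1 := by
  have hp1 : 1 ≤ p := by omega
  rw [matchesMoments_iff_coeff p n hp1,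
    coeff_eq_iff_eulerLogDeriv _ (constantCoeff_momentSeries p n hp1 a) constantCoeff_sinhc]
  simp only [coeff_eulerLogDeriv_momentSeries p n hp1 a ha]
  constructor
  · intro h k hk hkn
    have h1 := h (2 * k) (by omega)
    have hne : coeff (2 * k) (eulerLogDeriv sinhc) ≠ 0 := by
      intro h0
      have := coeff_even_eulerLogDeriv_sinhc_sign k hk
      simp [h0] at this
    exact mul_left_cancel₀ hne (by rw [h1, mul_one])
  · intro h m hm
    rcases Nat.even_or_odd' m with ⟨k, rfl | rfl⟩
    · rcases Nat.eq_zero_or_pos k with rfl | hk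
      · rw [mul_zero, coeff_zero_eulerLogDeriv, zero_mul]
      · rw [h k hk (by omega), mul_one]
    · rw [coeff_odd_eulerLogDeriv_sinhc _ (by simp), zero_mul]

end Moments

/-- The coefficients of the infinite product `∏ (1 - z q ^ j)`, `j ≥ 1`. -/
noncomputable def eulerCoeff (q : ℝ) : ℕ → ℝ
  | 0 => 1
  | k + 1 => -(q ^ (k + 1) / (1 - q ^ (k + 1))) * eulerCoeff q k

/-- The truncation of the power series of `∏ (1 - z q ^ j)`, `j ≥ 1`, to degree `n`. -/
noncomputable def eulerPoly (q : ℝ) (n : ℕ) : Polynomial ℝ :=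
  ∑ k ∈ Finset.range (n + 1), Polynomial.monomial k (eulerCoeff q k)

lemma eulerPoly_coeff (q : ℝ) (n k : ℕ) :
    (eulerPoly q n).coeff k = if k ≤ n then eulerCoeff q k else 0 := by
  simp [eulerPoly, Polynomial.finsetSum_coeff, Polynomial.coeff_monomial]

lemma eulerPoly_eval (q : ℝ) (n : ℕ) (z : ℝ) :
    (eulerPoly q n).eval z = ∑ k ∈ Finset.range (n + 1), eulerCoeff q k * z ^ k := by
  simp [eulerPoly, Polynomial.eval_finsetSum]

section PowerSums

open PowerSeries

lemma coeff_eulerLogDeriv_one_sub (x : ℝ) (k : ℕ) (hk : 1 ≤ k) :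
    coeff k (eulerLogDeriv (1 - C x * X)) = -x ^ k := by
  have h : eulerLogDeriv (1 - C x * X) = mk fun k => if k = 0 then 0 else -x ^ k := by
    apply eulerLogDeriv_eq (by simp)
    ext m
    rw [coeff_X_mul_derivative, mul_sub, mul_one, ← mul_assoc, mul_comm _ (C x), mul_assoc,
      map_sub, map_sub, coeff_C_mul, coeff_C_mul, coeff_mk]
    match m with
    | 0 => simp
    | 1 => rw [coeff_succ_mul_X, coeff_mk]; simp
    | m + 2 =>
      rw [coeff_succ_mul_X, coeff_mk, coeff_one, coeff_X]
      simp
      ring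
  rw [h, coeff_mk, if_neg (by omega)]

lemma coeff_eulerLogDeriv_prod_one_sub {n : ℕ} (x : Fin n → ℝ) (k : ℕ) (hk : 1 ≤ k) :
    coeff k (eulerLogDeriv (∏ j, (1 - C (x j) * X))) = -∑ j, x j ^ k := by
  rw [eulerLogDeriv_prod _ (by simp), map_sum, ← Finset.sum_neg_distrib]
  exact Finset.sum_congr rfl fun j _ => coeff_eulerLogDeriv_one_sub _ k hk

lemma eulerSeries_functional (q : ℝ) (h0 : 0 ≤ q) (h1 : q < 1) :
    mk (eulerCoeff q) = (1 - C q * X) * rescale q (mk (eulerCoeff q)) := by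
  ext m
  rw [sub_mul, one_mul, mul_assoc, map_sub, coeff_C_mul, coeff_mk, coeff_rescale, coeff_mk]
  cases m with
  | zero => simp
  | succ m =>
    have : (1 : ℝ) - q ^ (m + 1) ≠ 0 := by
      have : q ^ (m + 1) < 1 := pow_lt_one₀ h0 h1 (Nat.succ_ne_zero m)
      linarith
    rw [coeff_succ_X_mul, coeff_rescale, coeff_mk, eulerCoeff]
    field_simp
    ring

lemma coeff_eulerLogDeriv_eulerSeries (q : ℝ) (h0 : 0 ≤ q) (h1 : q < 1) (k : ℕ) (hk : 1 ≤ k) :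
    (1 - q ^ k) * coeff k (eulerLogDeriv (mk (eulerCoeff q))) = -q ^ k := by
  have hc : constantCoeff (mk (eulerCoeff q)) ≠ 0 := by
    rw [← coeff_zero_eq_constantCoeff_apply, coeff_mk]; simp [eulerCoeff]
  have hc' : constantCoeff (rescale q (mk (eulerCoeff q))) ≠ 0 := by
    rw [← coeff_zero_eq_constantCoeff_apply, coeff_rescale, coeff_mk]; simp [eulerCoeff]
  have h : coeff k (eulerLogDeriv (mk (eulerCoeff q))) =
      coeff k (eulerLogDeriv ((1 - C q * X) * rescale q (mk (eulerCoeff q)))) := by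
    rw [← eulerSeries_functional q h0 h1]
  rw [eulerLogDeriv_mul (by simp) hc', eulerLogDeriv_rescale hc, map_add, coeff_rescale,
    coeff_eulerLogDeriv_one_sub q k hk] at h
  linear_combination h

lemma power_sums_iff_prod_eq_eulerPoly (p n : ℕ) (hp : 2 ≤ p) (x : Fin n → ℝ) :
    (∀ k, 1 ≤ k → k ≤ n → ((p : ℝ) ^ (2 * k) - 1) * ∑ j, x j ^ k = 1) ↔
      ∏ j, (1 - Polynomial.C (x j) * Polynomial.X) = eulerPoly (((p : ℝ) ^ 2)⁻¹) n := by
  have hp' : (2 : ℝ) ≤ p := by exact_mod_cast hp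
  set q : ℝ := ((p : ℝ) ^ 2)⁻¹ with hq
  have hq0 : 0 < q := by positivity
  have hq1 : q < 1 := inv_lt_one_of_one_lt₀ (by nlinarith)
  have hcast : ((∏ j, (1 - Polynomial.C (x j) * Polynomial.X) : Polynomial ℝ) : ℝ⟦X⟧) =
      ∏ j, (1 - C (x j) * X) := by
    rw [← Polynomial.coeToPowerSeries.ringHom_apply, map_prod]
    simp
  have hdeg : (∏ j, (1 - Polynomial.C (x j) * Polynomial.X) : Polynomial ℝ).natDegree ≤ n := by
    refine (Polynomial.natDegree_prod_le _ _).trans ?_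
    refine (Finset.sum_le_card_nsmul _ _ 1 fun j _ => ?_).trans (by simp)
    compute_degree
  have hcoeff : (∏ j, (1 - Polynomial.C (x j) * Polynomial.X) = eulerPoly q n) ↔
      ∀ k ≤ n, coeff k (∏ j, (1 - C (x j) * X)) = coeff k (mk (eulerCoeff q)) := by
    rw [Polynomial.ext_iff, ← hcast]
    simp only [eulerPoly_coeff, Polynomial.coeff_coe, coeff_mk]
    refine forall_congr' fun k => ?_
    by_cases hk : k ≤ n
    · simp [hk]
    · simp only [hk, if_false, false_imp_iff, iff_true]
      exact Polynomial.coeff_eq_zero_of_natDegree_lt (by omega)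
  rw [hcoeff, coeff_eq_iff_eulerLogDeriv _ (by simp [map_prod])
    (by rw [← coeff_zero_eq_constantCoeff_apply, coeff_mk]; simp [eulerCoeff])]
  have key : ∀ k, 1 ≤ k → (((p : ℝ) ^ (2 * k) - 1) * ∑ j, x j ^ k = 1 ↔
      coeff k (eulerLogDeriv (∏ j, (1 - C (x j) * X))) =
        coeff k (eulerLogDeriv (mk (eulerCoeff q)))) := by
    intro k hk
    have h1 := coeff_eulerLogDeriv_eulerSeries q hq0.le hq1 k hk
    rw [coeff_eulerLogDeriv_prod_one_sub x k hk]
    have hqk : q ^ k * (p : ℝ) ^ (2 * k) = 1 := by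
      rw [hq, pow_mul, ← mul_pow, inv_mul_cancel₀ (by positivity), one_pow]
    have hlt : q ^ k < 1 := pow_lt_one₀ hq0.le hq1 (by omega)
    have hpos : 0 < q ^ k := by positivity
    constructor
    · intro h
      have h3 : (1 - q ^ k) * ∑ j, x j ^ k = q ^ k := by
        linear_combination q ^ k * h - (∑ j, x j ^ k) * hqk
      apply mul_left_cancel₀ (show (1 - q ^ k) ≠ 0 by linarith)
      rw [h1]
      linear_combination -h3
    · intro h
      rw [← h] at h1
      apply mul_left_cancel₀ hpos.ne'
      linear_combination (∑ j, x j ^ k) * hqk - h1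
  constructor
  · intro h k hk
    rcases Nat.eq_zero_or_pos k with rfl | h0
    · rw [coeff_zero_eulerLogDeriv, coeff_zero_eulerLogDeriv]
    · exact (key k h0).1 (h k h0 hk)
  · intro h k h0 hk
    exact (key k h0).2 (h k hk)

end PowerSums

lemma matchesMoments_iff_prod_eq_eulerPoly (p n : ℕ) (hp : 2 ≤ p) (a : Fin n → ℝ)
    (ha : ∀ j, 0 < a j) :
    MatchesMoments p n a ↔
      ∏ j, (1 - Polynomial.C (a j ^ 2) * Polynomial.X) = eulerPoly (((p : ℝ) ^ 2)⁻¹) n := by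
  rw [matchesMoments_iff_power_sums p n hp a ha, ← power_sums_iff_prod_eq_eulerPoly p n hp]
  simp only [pow_mul]

lemma range_subset_of_prod_eq {n : ℕ} {a b : Fin n → ℝ} (ha : ∀ j, 0 < a j)
    (hb : ∀ j, 0 < b j)
    (h : ∏ j, (1 - Polynomial.C (a j ^ 2) * Polynomial.X) =
      ∏ j, (1 - Polynomial.C (b j ^ 2) * Polynomial.X)) :
    Set.range a ⊆ Set.range b := by
  rintro _ ⟨i, rfl⟩
  have h0 := congrArg (Polynomial.eval ((a i ^ 2)⁻¹)) h
  simp only [Polynomial.eval_prod, Polynomial.eval_sub, Polynomial.eval_mul, Polynomial.eval_C,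
    Polynomial.eval_X, Polynomial.eval_one] at h0
  have hi : a i ^ 2 ≠ 0 := by have := ha i; positivity
  rw [Finset.prod_eq_zero (Finset.mem_univ i) (by rw [mul_inv_cancel₀ hi, sub_self]), eq_comm,
    Finset.prod_eq_zero_iff] at h0
  obtain ⟨j, -, hj⟩ := h0
  refine ⟨j, ?_⟩
  have : b j ^ 2 = a i ^ 2 := by
    rwa [sub_eq_zero, eq_comm, ← div_eq_mul_inv, div_eq_one_iff_eq hi] at hj
  exact (pow_left_inj₀ (hb j).le (ha i).le two_ne_zero).1 this

lemma matchesMoments_unique (p n : ℕ) (hp : 2 ≤ p) {a b : Fin n → ℝ} (ha : ∀ j, 0 < a j)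
    (hb : ∀ j, 0 < b j) (ha' : StrictAnti a) (hb' : StrictAnti b)
    (hma : MatchesMoments p n a) (hmb : MatchesMoments p n b) : b = a := by
  rw [matchesMoments_iff_prod_eq_eulerPoly p n hp _ ha] at hma
  rw [matchesMoments_iff_prod_eq_eulerPoly p n hp _ hb] at hmb
  have h := hma.trans hmb.symm
  exact (hb'.range_inj ha').1
    ((range_subset_of_prod_eq hb ha h.symm).antisymm (range_subset_of_prod_eq ha hb h))

/-- If the squared reciprocals of distinct positive numbers are roots of the truncated product,
those numbers solve the moment problem. -/
lemma matchesMoments_of_roots (p n : ℕ) (hp : 2 ≤ p) {a : Fin n → ℝ} (ha : ∀ j, 0 < a j)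
    (ha' : StrictAnti a)
    (hroot : ∀ j, (eulerPoly (((p : ℝ) ^ 2)⁻¹) n).eval ((a j ^ 2)⁻¹) = 0) :
    MatchesMoments p n a := by
  rw [matchesMoments_iff_prod_eq_eulerPoly p n hp _ ha]
  have hdeg : (∏ j, (1 - Polynomial.C (a j ^ 2) * Polynomial.X) : Polynomial ℝ).degree ≤ n := by
    refine Polynomial.natDegree_le_iff_degree_le.1 ((Polynomial.natDegree_prod_le _ _).trans ?_)
    refine (Finset.sum_le_card_nsmul _ _ 1 fun j _ => ?_).trans (by simp)
    compute_degree
  have hdeg' : (eulerPoly (((p : ℝ) ^ 2)⁻¹) n).degree ≤ n := by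
    rw [Polynomial.degree_le_iff_coeff_zero]
    intro m hm
    rw [eulerPoly_coeff, if_neg]
    exact not_le.2 (by exact_mod_cast hm)
  have hinj : Function.Injective fun j => (a j ^ 2)⁻¹ := by
    intro i j hij
    have : a i ^ 2 = a j ^ 2 := inv_injective hij
    exact ha'.injective ((pow_left_inj₀ (ha i).le (ha j).le two_ne_zero).1 this)
  let s : Finset ℝ := insert 0 (Finset.univ.image fun j => (a j ^ 2)⁻¹)
  have hs : s.card = n + 1 := by
    rw [Finset.card_insert_of_notMem, Finset.card_image_of_injective _ hinj]
    · simp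
    · simp only [Finset.mem_image, Finset.mem_univ, true_and, not_exists]
      intro j hj
      have := ha j
      exact absurd hj (by positivity)
  have hlt : ((n : ℕ) : WithBot ℕ) < (s.card : WithBot ℕ) := by
    rw [hs]; exact_mod_cast Nat.lt_succ_self n
  refine Polynomial.eq_of_degrees_lt_of_eval_finset_eq s (hdeg.trans_lt hlt) (hdeg'.trans_lt hlt) ?_
  intro z hz
  rw [Finset.mem_insert, Finset.mem_image] at hz
  rcases hz with rfl | ⟨j, -, rfl⟩
  · rw [Polynomial.eval_prod, ← Polynomial.coeff_zero_eq_eval_zero, eulerPoly_coeff]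
    simp [eulerCoeff]
  · rw [hroot, Polynomial.eval_prod]
    apply Finset.prod_eq_zero (Finset.mem_univ j)
    have : a j ^ 2 ≠ 0 := by have := ha j; positivity
    simp [this]

lemma eulerPoly_functional (q : ℝ) (h0 : 0 ≤ q) (h1 : q < 1) (n : ℕ) (z : ℝ) :
    (eulerPoly q n).eval z = (1 - q * z) * (eulerPoly q n).eval (q * z) +
      q ^ (n + 1) * eulerCoeff q n * z ^ (n + 1) := by
  simp only [eulerPoly_eval]
  induction n with
  | zero => simp [eulerCoeff]
  | succ n ih =>
    have : (1 : ℝ) - q ^ (n + 1) ≠ 0 := by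
      have : q ^ (n + 1) < 1 := pow_lt_one₀ h0 h1 (Nat.succ_ne_zero n)
      linarith
    have hc : (1 - q ^ (n + 1)) * eulerCoeff q (n + 1) = -q ^ (n + 1) * eulerCoeff q n := by
      rw [eulerCoeff]
      field_simp
    rw [Finset.sum_range_succ, ih, Finset.sum_range_succ _ (n + 1)]
    linear_combination z ^ (n + 1) * hc

lemma eulerCoeff_mul_prod (q : ℝ) (h0 : 0 ≤ q) (h1 : q < 1) (n : ℕ) :
    eulerCoeff q n * ∏ k ∈ Finset.range n, (1 - q ^ (k + 1)) =
      (-1) ^ n * ∏ k ∈ Finset.range n, q ^ (k + 1) := by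
  induction n with
  | zero => simp [eulerCoeff]
  | succ n ih =>
    have : (1 : ℝ) - q ^ (n + 1) ≠ 0 := by
      have : q ^ (n + 1) < 1 := pow_lt_one₀ h0 h1 (Nat.succ_ne_zero n)
      linarith
    have hc : eulerCoeff q (n + 1) * (1 - q ^ (n + 1)) = -q ^ (n + 1) * eulerCoeff q n := by
      rw [eulerCoeff]
      field_simp
    rw [Finset.prod_range_succ, Finset.prod_range_succ, pow_succ]
    linear_combination (∏ k ∈ Finset.range n, (1 - q ^ (k + 1))) * hc - q ^ (n + 1) * ih

lemma one_sub_le_prod_one_sub {q s : ℝ} (h0 : 0 < q) (h1 : q ≤ 1 / 4) (hs : 0 ≤ s) (hs2 : s ≤ 2)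
    (i : ℕ) : 1 - s / 3 ≤ ∏ l ∈ Finset.range i, (1 - s * q ^ (l + 1)) := by
  suffices h : 1 - s / 3 * (1 - q ^ i) ≤ ∏ l ∈ Finset.range i, (1 - s * q ^ (l + 1)) ∧
      ∏ l ∈ Finset.range i, (1 - s * q ^ (l + 1)) ≤ 1 by
    have : 0 ≤ s * q ^ i := by positivity
    linarith [h.1]
  induction i with
  | zero => simp
  | succ i ih =>
    obtain ⟨h2, h3⟩ := ih
    rw [Finset.prod_range_succ]
    set W := ∏ l ∈ Finset.range i, (1 - s * q ^ (l + 1))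
    have hqi : 0 < q ^ i := by positivity
    have hqi1 : q ^ i ≤ 1 := pow_le_one₀ h0.le (by linarith)
    have hd : 0 ≤ s * q ^ (i + 1) := by positivity
    have hW : 0 ≤ W := by nlinarith
    have hstep : s * q ^ (i + 1) ≤ s / 3 * (q ^ i - q ^ (i + 1)) := by
      rw [pow_succ]
      nlinarith [mul_nonneg hs hqi.le]
    constructor
    · nlinarith
    · nlinarith

lemma alternating_sum_bounds (N : ℕ) (u : ℕ → ℝ) (hu : Antitone u) (h0 : ∀ k, 0 ≤ u k) :
    0 ≤ ∑ k ∈ Finset.range N, (-1) ^ k * u k ∧ ∑ k ∈ Finset.range N, (-1) ^ k * u k ≤ u 0 := by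
  induction N generalizing u with
  | zero => simpa using h0 0
  | succ N ih =>
    have := ih (fun k => u (k + 1)) (fun a b h => hu (by omega)) fun k => h0 _
    rw [Finset.sum_range_succ']
    have h2 : ∑ k ∈ Finset.range N, (-1 : ℝ) ^ (k + 1) * u (k + 1) =
        -∑ k ∈ Finset.range N, (-1) ^ k * u (k + 1) := by
      rw [← Finset.sum_neg_distrib]
      exact Finset.sum_congr rfl fun k _ => by rw [pow_succ]; ring
    have h3 := hu (Nat.zero_le 1)
    rw [h2]
    simp only [zero_add] at this
    constructor <;> simp <;> linarith [this.1, this.2]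

lemma one_sub_le_eulerPoly_eval {q t : ℝ} (h0 : 0 < q) (h1 : q ≤ 1 / 4) (ht : 0 ≤ t)
    (ht2 : t ≤ 2) (n : ℕ) : 1 - t / 3 ≤ (eulerPoly q n).eval t := by
  let u : ℕ → ℝ := fun k => (-1) ^ k * (eulerCoeff q k * t ^ k)
  have hsucc : ∀ k, u (k + 1) = q ^ (k + 1) / (1 - q ^ (k + 1)) * t * u k := by
    intro k
    simp only [u, eulerCoeff]
    ring
  have hratio : ∀ k, 0 ≤ q ^ (k + 1) / (1 - q ^ (k + 1)) ∧
      q ^ (k + 1) / (1 - q ^ (k + 1)) ≤ 1 / 3 := by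
    intro k
    have h2 : q ^ (k + 1) ≤ 1 / 4 := by
      rw [pow_succ]
      have : q ^ k ≤ 1 := pow_le_one₀ h0.le (by linarith)
      nlinarith
    have h3 : 0 < q ^ (k + 1) := by positivity
    constructor
    · exact div_nonneg h3.le (by linarith)
    · rw [div_le_iff₀ (by linarith)]; linarith
  have hnn : ∀ k, 0 ≤ u k := by
    intro k
    induction k with
    | zero => simp [u, eulerCoeff]
    | succ k ih => rw [hsucc]; exact mul_nonneg (mul_nonneg (hratio k).1 ht) ih
  have hanti : Antitone u := by
    refine antitone_nat_of_succ_le fun k => ?_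
    rw [hsucc]
    refine mul_le_of_le_one_left (hnn k) ?_
    nlinarith [(hratio k).1, (hratio k).2]
  have hsum : (eulerPoly q n).eval t = ∑ k ∈ Finset.range (n + 1), (-1) ^ k * u k := by
    rw [eulerPoly_eval]
    refine Finset.sum_congr rfl fun k _ => ?_
    simp only [u]
    rw [← mul_assoc, ← mul_pow]
    simp
  have halt := (alternating_sum_bounds n (fun k => u (k + 1))
    (fun a b h => hanti (by omega)) fun k => hnn _).2
  have h2 : ∑ k ∈ Finset.range n, (-1 : ℝ) ^ (k + 1) * u (k + 1) =
      -∑ k ∈ Finset.range n, (-1) ^ k * u (k + 1) := by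
    rw [← Finset.sum_neg_distrib]
    exact Finset.sum_congr rfl fun k _ => by rw [pow_succ]; ring
  have hu0 : u 0 = 1 := by simp [u, eulerCoeff]
  have hu1 : u 1 ≤ t / 3 := by
    have := hsucc 0
    rw [hu0, mul_one] at this
    rw [this]
    nlinarith [(hratio 0).2]
  rw [hsum, Finset.sum_range_succ', h2, hu0]
  simp only [zero_add] at halt
  simp
  linarith

lemma exists_alternating_decomposition (ρ F : ℕ → ℝ) (β : ℝ) (h0 : ρ 0 = 1 + β) (i : ℕ)
    (hrec : ∀ k < i, ρ (k + 1) = 1 - F k * ρ k) (hF : ∀ k < i, 0 ≤ F k ∧ F k ≤ 1) :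
    ∃ A, 0 ≤ A ∧ A ≤ 1 ∧ ρ i = A + (-1) ^ i * β * ∏ k ∈ Finset.range i, F k := by
  induction i with
  | zero => exact ⟨1, by simp, by simp, by simp [h0]⟩
  | succ i ih =>
    obtain ⟨A, hA0, hA1, hA⟩ := ih (fun k hk => hrec k (by omega)) fun k hk => hF k (by omega)
    obtain ⟨hF0, hF1⟩ := hF i (by omega)
    refine ⟨1 - F i * A, by nlinarith, by nlinarith, ?_⟩
    rw [hrec i (by omega), hA, Finset.prod_range_succ, pow_succ]
    ring

lemma eulerCoeff_ne_zero {q : ℝ} (h0 : 0 < q) (h1 : q < 1) (n : ℕ) : eulerCoeff q n ≠ 0 := by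
  intro h
  have h2 := eulerCoeff_mul_prod q h0.le h1 n
  rw [h, zero_mul, eq_comm, mul_eq_zero] at h2
  rcases h2 with h2 | h2
  · exact absurd h2 (by simp)
  · exact absurd h2 (Finset.prod_pos fun k _ => by positivity).ne'

/-- The value of the truncated product at `t / q ^ (i + 1)`, suitably normalized, is a number in
`[0, 1]` plus a signed product which vanishes at `t = 1`. -/
lemma eulerPoly_eval_decomposition {q t : ℝ} (h0 : 0 < q) (h1 : q ≤ 1 / 4) (ht : 1 / 4 ≤ t)
    (ht2 : t ≤ 2) (n i : ℕ) (hi : i < n) :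
    ∃ A, 0 ≤ A ∧ A ≤ 1 ∧
      (eulerPoly q n).eval (t / q ^ (i + 1)) / eulerCoeff q n = (t / q ^ i) ^ (n + 1) *
        (A + (-1) ^ i * ((1 - t) * (eulerPoly q n).eval t / (eulerCoeff q n * t ^ (n + 1))) *
          ∏ k ∈ Finset.range i, (q ^ (n - k) * (t - q ^ (k + 1)))) := by
  have hq1 : q < 1 := by linarith
  have ht0 : 0 < t := by linarith
  have hc := eulerCoeff_ne_zero h0 hq1 n
  let ρ : ℕ → ℝ := fun k =>
    (eulerPoly q n).eval (t / q ^ (k + 1)) / (eulerCoeff q n * (t / q ^ k) ^ (n + 1))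
  have hρ0 : ρ 0 = 1 + (1 - t) * (eulerPoly q n).eval t / (eulerCoeff q n * t ^ (n + 1)) := by
    simp only [ρ]
    rw [eulerPoly_functional q h0.le hq1, zero_add, pow_one, mul_div_cancel₀ _ h0.ne',
      mul_right_comm, ← mul_pow, mul_div_cancel₀ _ h0.ne', pow_zero, div_one]
    field_simp
    ring
  have hrec : ∀ k < i, ρ (k + 1) = 1 - q ^ (n - k) * (t - q ^ (k + 1)) * ρ k := by
    intro k hk
    simp only [ρ]
    have e : q * (t / q ^ (k + 1 + 1)) = t / q ^ (k + 1) := by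
      rw [pow_succ q (k + 1)]; field_simp
    have e2 : q ^ (n + 1) = q ^ (n - k) * q ^ (k + 1) := by
      rw [← pow_add]; congr 1; omega
    have e3 : q ^ (n + 1) * (t / q ^ (k + 1 + 1)) ^ (n + 1) = (t / q ^ (k + 1)) ^ (n + 1) := by
      rw [← mul_pow, e]
    have e4 : (t / q ^ k) ^ (n + 1) = q ^ (n + 1) * (t / q ^ (k + 1)) ^ (n + 1) := by
      rw [← mul_pow, pow_succ q k]; congr 1; field_simp
    have hv : (t / q ^ (k + 1)) ^ (n + 1) ≠ 0 := by positivity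
    have hqk : q ^ (k + 1) ≠ 0 := by positivity
    have hqn : q ^ (n - k) ≠ 0 := by positivity
    rw [eulerPoly_functional q h0.le hq1, e, mul_assoc, mul_left_comm, e3, e4, e2]
    generalize (eulerPoly q n).eval (t / q ^ (k + 1)) = y
    generalize (t / q ^ (k + 1)) ^ (n + 1) = v at hv
    field_simp
    ring
  have hF : ∀ k < i, 0 ≤ q ^ (n - k) * (t - q ^ (k + 1)) ∧
      q ^ (n - k) * (t - q ^ (k + 1)) ≤ 1 := by
    intro k hk
    have h2 : q ^ (k + 1) ≤ q := pow_le_of_le_one h0.le hq1.le (by omega)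
    have h3 : q ^ (n - k) ≤ q := pow_le_of_le_one h0.le hq1.le (by omega)
    have h4 : 0 < q ^ (n - k) := by positivity
    have h5 : 0 < q ^ (k + 1) := by positivity
    constructor
    · exact mul_nonneg h4.le (by linarith)
    · nlinarith
  obtain ⟨A, hA0, hA1, hA⟩ := exists_alternating_decomposition ρ _ _ hρ0 i hrec hF
  refine ⟨A, hA0, hA1, ?_⟩
  rw [← hA]
  simp only [ρ]
  have hv : (t / q ^ i) ^ (n + 1) ≠ 0 := by positivity
  generalize (t / q ^ i) ^ (n + 1) = v at hv
  field_simp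

lemma eulerPoly_eval_sign_at_pow {q : ℝ} (h0 : 0 < q) (h1 : q ≤ 1 / 4) (n i : ℕ) (hi : i < n) :
    0 ≤ (eulerPoly q n).eval (1 / q ^ (i + 1)) / eulerCoeff q n := by
  obtain ⟨A, hA0, -, hA⟩ := eulerPoly_eval_decomposition (t := 1) h0 h1 (by norm_num)
    (by norm_num) n i hi
  rw [hA]
  simp only [sub_self, zero_mul, zero_div, mul_zero, add_zero]
  positivity

lemma prod_range_pow_le {q : ℝ} (h0 : 0 < q) (h1 : q ≤ 1) (M : ℕ) :
    ∏ k ∈ Finset.range (M + 1), q ^ (k + 1) ≤ q ^ (2 * M + 1) := by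
  induction M with
  | zero => simp
  | succ M ih =>
    rw [Finset.prod_range_succ]
    calc _ ≤ q ^ (2 * M + 1) * q ^ 2 := by
          refine mul_le_mul ih (pow_le_pow_of_le_one h0.le h1 (by omega)) (by positivity)
            (by positivity)
      _ = _ := by rw [← pow_add]; congr 1

lemma eulerPoly_eval_sign_near_pow {q u : ℝ} (h0 : 0 < q) (h1 : q ≤ 1 / 4) (hu : 1 / 2 ≤ u)
    (hu2 : u ≤ 2) (M i : ℕ)
    (h : q ^ (2 * M + 1) ≤
      u ^ M * ((-1) ^ M * (u - 1)) * ((u - 1 / 3) * (2 / 3) * (1 - u / 3))) :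
    (eulerPoly q (M + 1 + i)).eval (u⁻¹ / q ^ (i + 1)) / eulerCoeff q (M + 1 + i) ≤ 0 := by
  have hu0 : 0 < u := by linarith
  have hq1 : q < 1 := by linarith
  have ht1 : 1 / 4 ≤ u⁻¹ := by
    rw [le_inv_comm₀ (by norm_num) hu0]; linarith
  have ht2 : u⁻¹ ≤ 2 := by
    rw [inv_le_comm₀ hu0 (by norm_num)]; linarith
  obtain ⟨A, -, hA1, hA⟩ := eulerPoly_eval_decomposition h0 h1 ht1 ht2 (M + 1 + i) i (by omega)
  rw [hA]
  refine mul_nonpos_of_nonneg_of_nonpos (by positivity) ?_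
  have hE := one_sub_le_eulerPoly_eval h0 h1 (by positivity) ht2 (M + 1 + i)
  have hW := one_sub_le_prod_one_sub h0 h1 hu0.le hu2 i
  have hQ := one_sub_le_prod_one_sub (s := 1) h0 h1 zero_le_one one_le_two (M + 1 + i)
  have hcQ := eulerCoeff_mul_prod q h0.le hq1 (M + 1 + i)
  have hc := eulerCoeff_ne_zero h0 hq1 (M + 1 + i)
  have hT := prod_range_pow_le h0 hq1.le M
  simp only [one_mul] at hQ
  have hsplit : ∏ k ∈ Finset.range (M + 1 + i), q ^ (k + 1) =
      (∏ k ∈ Finset.range (M + 1), q ^ (k + 1)) *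
        ∏ k ∈ Finset.range i, q ^ (M + 1 + i - k) := by
    rw [Finset.prod_range_add, ← Finset.prod_range_reflect (fun k => q ^ (M + 1 + k + 1)) i]
    congr 1
    refine Finset.prod_congr rfl fun k hk => ?_
    rw [Finset.mem_range] at hk
    congr 1
    omega
  have hfac : ∏ k ∈ Finset.range i, (u⁻¹ - q ^ (k + 1)) =
      (u⁻¹) ^ i * ∏ k ∈ Finset.range i, (1 - u * q ^ (k + 1)) := by
    rw [← Finset.card_range i, ← Finset.prod_const, Finset.card_range, ← Finset.prod_mul_distrib]
    refine Finset.prod_congr rfl fun k _ => ?_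
    field_simp
  rw [Finset.prod_mul_distrib, hfac]
  rw [hsplit] at hcQ
  set E := (eulerPoly q (M + 1 + i)).eval u⁻¹
  set c := eulerCoeff q (M + 1 + i)
  set W := ∏ k ∈ Finset.range i, (1 - u * q ^ (k + 1))
  set Q := ∏ k ∈ Finset.range (M + 1 + i), (1 - q ^ (k + 1))
  set T := ∏ k ∈ Finset.range (M + 1), q ^ (k + 1)
  have hR : 0 < ∏ k ∈ Finset.range i, q ^ (M + 1 + i - k) :=
    Finset.prod_pos fun k _ => by positivity
  have hTpos : 0 < T := Finset.prod_pos fun k _ => by positivity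
  set R := ∏ k ∈ Finset.range i, q ^ (M + 1 + i - k)
  have hQ0 : 0 < Q := by linarith
  have hcinv : c = (-1) ^ (M + 1 + i) * (T * R) / Q := by
    rw [eq_div_iff hQ0.ne', hcQ]
  have hs : (-1 : ℝ) ^ i * ((1 - u⁻¹) * E / (c * u⁻¹ ^ (M + 1 + i + 1))) *
      (R * (u⁻¹ ^ i * W)) = -(u ^ M * ((-1) ^ M * (u - 1)) * ((u * E) * Q * W) / T) := by
    have hsi : ((-1 : ℝ) ^ i) ^ 2 = 1 := by rw [← pow_mul, mul_comm, pow_mul]; simp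
    have hsM : ((-1 : ℝ) ^ M) ^ 2 = 1 := by rw [← pow_mul, mul_comm, pow_mul]; simp
    have hsi0 : (-1 : ℝ) ^ i ≠ 0 := by simp
    have hsM0 : (-1 : ℝ) ^ M ≠ 0 := by simp
    rw [hcinv]
    simp only [pow_add, pow_one, inv_pow]
    generalize (-1 : ℝ) ^ i = x at *
    generalize (-1 : ℝ) ^ M = y at *
    field_simp
    rw [hsM]
    ring
  rw [hs]
  have huE : u - 1 / 3 ≤ u * E := by
    calc u - 1 / 3 = u * (1 - u⁻¹ / 3) := by field_simp
      _ ≤ u * E := mul_le_mul_of_nonneg_left hE hu0.le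
  have hprod : (u - 1 / 3) * (2 / 3) * (1 - u / 3) ≤ (u * E) * Q * W := by
    have h23 : 2 / 3 ≤ Q := by linarith
    exact mul_le_mul (mul_le_mul huE h23 (by norm_num) (by linarith)) hW (by linarith)
      (mul_nonneg (by linarith) hQ0.le)
  have hη : 0 ≤ u ^ M * ((-1) ^ M * (u - 1)) := by
    refine nonneg_of_mul_nonneg_left ((by positivity : 0 ≤ q ^ (2 * M + 1)).trans h) ?_
    have : 0 < u - 1 / 3 := by linarith
    have : 0 < 1 - u / 3 := by linarith
    positivity
  have : 1 ≤ u ^ M * ((-1) ^ M * (u - 1)) * ((u * E) * Q * W) / T := by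
    rw [le_div_iff₀ hTpos, one_mul]
    exact hT.trans (h.trans (mul_le_mul_of_nonneg_left hprod hη))
  linarith

lemma exists_sign_near_one {q : ℝ} (h0 : 0 < q) (h1 : q ≤ 1 / 4) (M : ℕ) :
    ∃ u : ℝ, 1 / 2 ≤ u ∧ u ≤ 2 ∧
      q ^ (2 * M + 1) ≤
        u ^ M * ((-1) ^ M * (u - 1)) * ((u - 1 / 3) * (2 / 3) * (1 - u / 3)) ∧
      1 - 2 * q ^ (M + 1) ≤ u ∧ u ≤ 1 + 4 * q ^ (M + 1) := by
  have hqM : q ^ M ≤ 1 := pow_le_one₀ h0.le (by linarith)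
  have hqM0 : 0 < q ^ M := by positivity
  have hh0 : 0 < q ^ (M + 1) := by positivity
  have e : q ^ (2 * M + 1) = q ^ (M + 1) * q ^ M := by rw [← pow_add]; congr 1; omega
  rcases Nat.even_or_odd M with hM | hM
  · have hh : q ^ (M + 1) ≤ 1 / 4 := by rw [pow_succ]; nlinarith
    refine ⟨1 + 4 * q ^ (M + 1), by linarith, by linarith, ?_, by linarith, le_rfl⟩
    rw [e, hM.neg_one_pow]
    set h := q ^ (M + 1)
    have hu : 1 ≤ (1 + 4 * h) ^ M := one_le_pow₀ (by linarith)
    have hg : 1 / 4 ≤ (1 + 4 * h - 1 / 3) * (2 / 3) * (1 - (1 + 4 * h) / 3) := by nlinarith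
    calc h * q ^ M ≤ h * 1 := by gcongr
      _ = 1 * (1 * (1 + 4 * h - 1)) * (1 / 4) := by ring
      _ ≤ _ := by
        refine mul_le_mul (mul_le_mul_of_nonneg_right hu (by linarith)) hg (by norm_num) ?_
        exact mul_nonneg (by linarith) (by linarith)
  · have hM1 : 1 ≤ M := hM.pos
    have hqq : q ^ M ≤ 1 / 4 := (pow_le_of_le_one h0.le (by linarith) (by omega)).trans h1
    have hh : q ^ (M + 1) ≤ 1 / 16 := by rw [pow_succ]; nlinarith
    refine ⟨1 - 2 * q ^ (M + 1), by linarith, by linarith, ?_, le_rfl, by linarith⟩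
    rw [e, hM.neg_one_pow]
    set h := q ^ (M + 1)
    have hg : 1 / 5 ≤ (1 - 2 * h - 1 / 3) * (2 / 3) * (1 - (1 - 2 * h) / 3) := by nlinarith
    have hu : 5 / 2 * q ^ M ≤ (1 - 2 * h) ^ M := by
      calc 5 / 2 * q ^ M ≤ (5 / 2) ^ M * q ^ M := by
            gcongr
            exact le_self_pow₀ (by norm_num) (by omega)
        _ = (5 / 2 * q) ^ M := (mul_pow _ _ _).symm
        _ ≤ _ := by gcongr; linarith
    calc h * q ^ M = 5 / 2 * q ^ M * (-1 * (1 - 2 * h - 1)) * (1 / 5) := by ring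
      _ ≤ _ := by
        refine mul_le_mul (mul_le_mul_of_nonneg_right hu (by linarith)) hg (by norm_num) ?_
        exact mul_nonneg (by linarith) (by linarith)

lemma exists_eulerPoly_root_near {r : ℝ} (h0 : 0 < r) (h1 : r ≤ 1 / 2) (n i : ℕ) (hi : i < n) :
    ∃ b : ℝ, 0 < b ∧ |b - 1| ≤ 2 * (r ^ 2) ^ (n - i) ∧
      (eulerPoly (r ^ 2) n).eval (((b * r ^ (i + 1)) ^ 2)⁻¹) = 0 := by
  obtain ⟨M, rfl⟩ : ∃ M, n = M + 1 + i := ⟨n - 1 - i, by omega⟩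
  rw [Nat.add_sub_cancel]
  have hq0 : 0 < r ^ 2 := by positivity
  have hq1 : r ^ 2 ≤ 1 / 4 := by nlinarith
  obtain ⟨u, hu1, hu2, hu, hul, huu⟩ := exists_sign_near_one hq0 hq1 M
  have hneg := eulerPoly_eval_sign_near_pow hq0 hq1 hu1 hu2 M i hu
  have hpos := eulerPoly_eval_sign_at_pow hq0 hq1 (M + 1 + i) i hi
  have hc := eulerCoeff_ne_zero hq0 (by linarith) (M + 1 + i)
  have hmem : ∀ v ∈ Set.uIcc u 1, min u 1 ≤ v ∧ v ≤ max u 1 := fun v hv => hv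
  have hmin : 1 / 2 ≤ min u 1 := le_min hu1 (by norm_num)
  have hcont : ContinuousOn
      (fun v : ℝ => (eulerPoly (r ^ 2) (M + 1 + i)).eval (v⁻¹ / (r ^ 2) ^ (i + 1)) /
        eulerCoeff (r ^ 2) (M + 1 + i)) (Set.uIcc u 1) := by
    refine ContinuousOn.div_const ?_ _
    refine (Polynomial.continuous _).comp_continuousOn (ContinuousOn.div_const ?_ _)
    exact continuousOn_inv₀.mono fun v hv => by
      have := (hmem v hv).1
      have : 0 < v := by linarith
      exact this.ne'
  obtain ⟨v, hv, hv0⟩ := intermediate_value_uIcc hcont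
    (Set.mem_uIcc_of_le hneg (by simpa using hpos))
  have hvl : 1 - 2 * (r ^ 2) ^ (M + 1) ≤ v :=
    (le_min hul (by linarith [pow_pos hq0 (M + 1)])).trans (hmem v hv).1
  have hvu : v ≤ 1 + 4 * (r ^ 2) ^ (M + 1) :=
    (hmem v hv).2.trans (max_le huu (by linarith [pow_pos hq0 (M + 1)]))
  have hvpos : 0 < v := by linarith [(hmem v hv).1]
  have hh := pow_pos hq0 (M + 1)
  have hb := Real.sqrt_pos.mpr hvpos
  have hbsq := Real.sq_sqrt hvpos.le
  refine ⟨√v, hb, ?_, ?_⟩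
  · rw [abs_le]
    constructor
    · nlinarith
    · nlinarith
  · have : ((√v * r ^ (i + 1)) ^ 2)⁻¹ = v⁻¹ / (r ^ 2) ^ (i + 1) := by
      rw [mul_pow, hbsq, mul_inv, div_eq_mul_inv, ← pow_mul, ← pow_mul, mul_comm 2]
    rw [this]
    exact (div_eq_zero_iff.mp hv0).resolve_right hc

lemma sum_pow_mul_pow_lt {r : ℝ} (h0 : 0 < r) (h1 : r ≤ 1 / 2) (n : ℕ) :
    ∑ j : Fin n, 2 * (r ^ 2) ^ (n - j) * r ^ ((j : ℕ) + 1) < r ^ (n + 1) / (1 - r) := by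
  rw [Fin.sum_univ_eq_sum_range (fun j => 2 * (r ^ 2) ^ (n - j) * r ^ (j + 1)) n]
  have hterm : ∀ j ∈ Finset.range n, 2 * (r ^ 2) ^ (n - j) * r ^ (j + 1) =
      2 * r ^ (n + 2) * r ^ (n - 1 - j) := by
    intro j hj
    rw [Finset.mem_range] at hj
    rw [← pow_mul, mul_assoc, mul_assoc, ← pow_add, ← pow_add]
    congr 2
    omega
  rw [Finset.sum_congr rfl hterm, ← Finset.mul_sum, Finset.sum_range_reflect (fun j => r ^ j) n,
    lt_div_iff₀ (by linarith), mul_assoc, geom_sum_mul_neg, pow_succ r (n + 1)]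
  have hn : 0 < r ^ n := by positivity
  have hn1 : 0 < r ^ (n + 1) := by positivity
  nlinarith [mul_pos (mul_pos hn1 h0) hn]

theorem stmt_0 (p : ℕ) (hp : 2 ≤ p) (n : ℕ) (hn : 1 ≤ n) :
    ∃ a : Fin n → ℝ,
      (StrictAnti a ∧ (∀ j, 0 < a j) ∧ MatchesMoments p n a ∧
        ∑ j : Fin n, |a j - ((p : ℝ) ^ ((j : ℕ) + 1))⁻¹|
          < 1 / ((p : ℝ) ^ n * ((p : ℝ) - 1))) ∧
      ∀ b : Fin n → ℝ,
        StrictAnti b → (∀ j, 0 < b j) → MatchesMoments p n b → b = a := by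
  have hp2 : (2 : ℝ) ≤ p := by exact_mod_cast hp
  have hp0 : (0 : ℝ) < p := by linarith
  obtain ⟨r, hr⟩ : ∃ r : ℝ, r = (p : ℝ)⁻¹ := ⟨_, rfl⟩
  have h0 : 0 < r := by rw [hr]; positivity
  have h1 : r ≤ 1 / 2 := by
    rw [hr, inv_le_comm₀ hp0 (by norm_num)]
    linarith
  choose b hb0 hb hroot using fun j : Fin n => exists_eulerPoly_root_near h0 h1 n j j.isLt
  have ha0 : ∀ j : Fin n, 0 < b j * r ^ ((j : ℕ) + 1) := fun j =>
    mul_pos (hb0 j) (by positivity)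
  have hq1 : r ^ 2 ≤ 1 / 4 := by nlinarith
  have hanti : StrictAnti fun j : Fin n => b j * r ^ ((j : ℕ) + 1) := by
    intro i j hij
    have hij' : (i : ℕ) < j := hij
    have hjn := j.isLt
    have hbj : b j ≤ 3 / 2 := by
      have h2 : (r ^ 2) ^ (n - j) ≤ 1 / 4 :=
        (pow_le_of_le_one (by positivity) (by linarith) (by omega)).trans hq1
      linarith [(abs_le.mp (hb j)).2]
    have hbi : 7 / 8 ≤ b i := by
      have h2 : (r ^ 2) ^ (n - i) ≤ (r ^ 2) ^ 2 :=
        pow_le_pow_of_le_one (by positivity) (by linarith) (by omega)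
      have h3 : (r ^ 2) ^ 2 ≤ 1 / 16 := by nlinarith [sq_nonneg r]
      linarith [(abs_le.mp (hb i)).1]
    have hri : 0 < r ^ ((i : ℕ) + 1) := by positivity
    have hrj : r ^ ((j : ℕ) + 1) ≤ r ^ ((i : ℕ) + 1) * r := by
      rw [← pow_succ]
      exact pow_le_pow_of_le_one h0.le (by linarith) (by omega)
    have hrj0 : 0 < r ^ ((j : ℕ) + 1) := by positivity
    show b j * r ^ ((j : ℕ) + 1) < b i * r ^ ((i : ℕ) + 1)
    nlinarith
  have hmatch : MatchesMoments p n fun j : Fin n => b j * r ^ ((j : ℕ) + 1) := by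
    refine matchesMoments_of_roots p n hp ha0 hanti fun j => ?_
    rw [← inv_pow (p : ℝ), ← hr]
    exact hroot j
  refine ⟨_, ⟨hanti, ha0, hmatch, ?_⟩, fun c hc hc0 hcm =>
    matchesMoments_unique p n hp ha0 hc0 hanti hc hmatch hcm⟩
  calc ∑ j : Fin n, |b j * r ^ ((j : ℕ) + 1) - ((p : ℝ) ^ ((j : ℕ) + 1))⁻¹|
      ≤ ∑ j : Fin n, 2 * (r ^ 2) ^ (n - j) * r ^ ((j : ℕ) + 1) := by
        refine Finset.sum_le_sum fun j _ => ?_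
        have hrj : 0 < r ^ ((j : ℕ) + 1) := by positivity
        rw [← inv_pow, ← hr, ← sub_one_mul, abs_mul, abs_of_pos hrj]
        exact mul_le_mul_of_nonneg_right (hb j) hrj.le
    _ < r ^ (n + 1) / (1 - r) := sum_pow_mul_pow_lt h0 h1 n
    _ = 1 / ((p : ℝ) ^ n * ((p : ℝ) - 1)) := by
        have : (p : ℝ) - 1 ≠ 0 := by linarith
        rw [hr, inv_pow]
        field_simp
        ring
end

section
/- For every odd positive integer m and every t in the open interval (−π/2, π/2), the m-th derivative of the tangent function at t is strictly positive. -/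
open Real

open Polynomial in
/-- A polynomial with natural number coefficients is nonnegative on nonnegative reals. -/
theorem aeval_nonneg_of_nonneg (Q : ℕ[X]) {x : ℝ} (hx : 0 ≤ x) : 0 ≤ aeval x Q := by
  rw [aeval_eq_sum_range]
  exact Finset.sum_nonneg fun i _ => by positivity

open Polynomial in
theorem aeval_pos_of_coeff_zero_pos {Q : ℕ[X]} (hQ : 0 < Q.coeff 0) {x : ℝ} (hx : 0 ≤ x) :
    0 < aeval x Q := by
  rw [← Q.divX_mul_X_add]
  have h := aeval_nonneg_of_nonneg Q.divX hx
  simp only [map_add, map_mul, aeval_X, eq_natCast, map_natCast]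
  positivity

theorem hasDerivAt_tan_sq_add_one {t : ℝ} (ht : t ∈ Set.Ioo (-(π / 2)) (π / 2)) :
    HasDerivAt tan (tan t ^ 2 + 1) t := by
  have hc : cos t ≠ 0 := (cos_pos_of_mem_Ioo ht).ne'
  convert hasDerivAt_tan hc using 1
  rw [tan_eq_sin_div_cos]
  field_simp
  exact sin_sq_add_cos_sq t

open Polynomial in
theorem hasDerivAt_aeval_tan_sq (Q : ℕ[X]) {t : ℝ} (ht : t ∈ Set.Ioo (-(π / 2)) (π / 2)) :
    HasDerivAt (fun s => aeval (tan s ^ 2) Q)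
      (tan t * aeval (tan t ^ 2) (2 * (X + 1) * derivative Q)) t := by
  have h := (Q.hasDerivAt_aeval (tan t ^ 2)).comp t ((hasDerivAt_tan_sq_add_one ht).pow 2)
  refine h.congr_deriv ?_
  simp [map_ofNat (aeval (tan t ^ 2) : ℕ[X] →ₐ[ℕ] ℝ) 2]
  ring

open Polynomial in
theorem hasDerivAt_tan_mul_aeval_tan_sq (R : ℕ[X]) {t : ℝ}
    (ht : t ∈ Set.Ioo (-(π / 2)) (π / 2)) :
    HasDerivAt (fun s => tan s * aeval (tan s ^ 2) R)
      (aeval (tan t ^ 2) ((X + 1) * (R + 2 * X * derivative R))) t := by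
  refine ((hasDerivAt_tan_sq_add_one ht).mul (hasDerivAt_aeval_tan_sq R ht)).congr_deriv ?_
  simp
  ring

theorem eqOn_iteratedDeriv_succ {f g g' : ℝ → ℝ} {s : Set ℝ} (hs : IsOpen s) {n : ℕ}
    (h : Set.EqOn (iteratedDeriv n f) g s) (hg : ∀ x ∈ s, HasDerivAt g (g' x) x) :
    Set.EqOn (iteratedDeriv (n + 1) f) g' s := fun x hx => by
  rw [iteratedDeriv_succ, (h.eventuallyEq_of_mem (hs.mem_nhds hx)).deriv_eq, (hg x hx).deriv]

open Polynomial in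
/-- The odd derivatives of `tan` are polynomials in `tan ^ 2` with natural number coefficients. -/
theorem exists_eqOn_iteratedDeriv_tan (k : ℕ) :
    ∃ Q : ℕ[X], 0 < Q.coeff 0 ∧ 0 < Q.coeff 1 ∧
      Set.EqOn (iteratedDeriv (2 * k + 1) tan) (fun t => aeval (tan t ^ 2) Q)
        (Set.Ioo (-(π / 2)) (π / 2)) := by
  induction k with
  | zero =>
    refine ⟨X + 1, by simp, by simp [coeff_one], ?_⟩
    refine eqOn_iteratedDeriv_succ isOpen_Ioo (g := tan) (fun x _ => by simp) fun x hx => ?_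
    simpa using hasDerivAt_tan_sq_add_one hx
  | succ k ih =>
    obtain ⟨Q, -, h1, hQ⟩ := ih
    have hR : 0 < (2 * (X + 1) * derivative Q).coeff 0 := by
      simpa [mul_coeff_zero, coeff_derivative] using h1
    generalize hRQ : 2 * (X + 1) * derivative Q = R at hR
    refine ⟨(X + 1) * (R + 2 * X * derivative R), ?_, ?_, ?_⟩
    · simpa [mul_coeff_zero] using hR
    · rw [add_mul, coeff_add, coeff_X_mul, coeff_add]
      omega
    · refine eqOn_iteratedDeriv_succ isOpen_Ioo
        (eqOn_iteratedDeriv_succ isOpen_Ioo hQ fun x hx => hasDerivAt_aeval_tan_sq Q hx)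
        fun x hx => ?_
      rw [hRQ]
      exact hasDerivAt_tan_mul_aeval_tan_sq R hx

theorem stmt_5 (m : ℕ) (hm : Odd m) (t : ℝ)
    (ht : t ∈ Set.Ioo (-(π / 2)) (π / 2)) :
    0 < iteratedDeriv m Real.tan t := by
  obtain ⟨k, rfl⟩ := hm
  obtain ⟨Q, h0, -, hQ⟩ := exists_eqOn_iteratedDeriv_tan k
  rw [hQ ht]
  exact aeval_pos_of_coeff_zero_pos h0 (sq_nonneg _)
end

section
/- Let q be a real number with q > 1, let n ≥ 1, and let b₁, …, bₙ be real (or complex) numbers satisfying ∑_{j=1}^n b_j^k = 1/(q^k − 1) for all 1 ≤ k ≤ n. Then ∏_{j=1}^n (1 − b_j x) = ∑_{k=0}^n x^k / ((1−q)(1−q²)⋯(1−q^k)) as polynomials in x (the k = 0 term being 1). -/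
open Polynomial

/-- The coefficient `1 / ((1 - q) ⋯ (1 - q ^ k))` of the `q`-exponential series. -/
noncomputable def qExpCoeff {K : Type*} [Field K] (q : K) (k : ℕ) : K :=
  (∏ i ∈ Finset.range k, (1 - q ^ (i + 1)))⁻¹

section qExpCoeff

variable {K : Type*} [Field K] {q : K}

lemma qExpCoeff_zero : qExpCoeff q 0 = 1 := by simp [qExpCoeff]

lemma qExpCoeff_succ_mul (hq : ∀ k : ℕ, 1 - q ^ (k + 1) ≠ 0) (k : ℕ) :
    qExpCoeff q (k + 1) * (1 - q ^ (k + 1)) = qExpCoeff q k := by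
  rw [qExpCoeff, qExpCoeff, Finset.prod_range_succ, mul_inv, mul_assoc,
    inv_mul_cancel₀ (hq k), mul_one]

lemma sum_qExpCoeff_mul_pow (hq : ∀ k : ℕ, 1 - q ^ (k + 1) ≠ 0) (k : ℕ) :
    ∑ j ∈ Finset.range (k + 1), qExpCoeff q j * q ^ j = qExpCoeff q k := by
  induction k with
  | zero => simp
  | succ k ih =>
    rw [Finset.sum_range_succ, ih]
    linear_combination -qExpCoeff_succ_mul hq k

/-- The logarithmic-derivative recurrence for the coefficients of the `q`-exponential series. -/
lemma natCast_mul_qExpCoeff (hq : ∀ k : ℕ, 1 - q ^ (k + 1) ≠ 0) (k : ℕ) :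
    k * qExpCoeff q k = ∑ j ∈ Finset.range k, qExpCoeff q j / (1 - q ^ (k - j)) := by
  induction k with
  | zero => simp
  | succ k ih =>
    have hsplit : (∑ j ∈ Finset.range (k + 1), qExpCoeff q j / (1 - q ^ (k + 1 - j))) *
        (1 - q ^ (k + 1)) = ∑ j ∈ Finset.range (k + 1), qExpCoeff q j * q ^ j +
          ∑ j ∈ Finset.range (k + 1),
            qExpCoeff q j * (1 - q ^ j) / (1 - q ^ (k + 1 - j)) := by
      rw [Finset.sum_mul, ← Finset.sum_add_distrib]
      refine Finset.sum_congr rfl fun j hj => ?_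
      obtain ⟨m, rfl⟩ := Nat.exists_eq_add_of_le (Finset.mem_range_succ_iff.mp hj)
      rw [show j + m + 1 - j = m + 1 by omega]
      have := hq m
      field_simp
      ring
    refine mul_right_cancel₀ (hq k) ?_
    rw [hsplit, sum_qExpCoeff_mul_pow hq, Finset.sum_range_succ', mul_assoc,
      qExpCoeff_succ_mul hq]
    simp only [qExpCoeff_succ_mul hq, Nat.add_sub_add_right, ← ih, pow_zero, sub_self, mul_zero,
      zero_div, add_zero]
    push_cast
    ring

end qExpCoeff

/-- Newton's identities for the signed elementary symmetric functions of a finite family. -/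
lemma natCast_mul_signed_esymm {ι R : Type*} [Fintype ι] [CommRing R] (b : ι → R) (k : ℕ) :
    k * ((-1) ^ k * MvPolynomial.aeval b (MvPolynomial.esymm ι R k)) =
      -∑ j ∈ Finset.range k,
        ((-1) ^ j * MvPolynomial.aeval b (MvPolynomial.esymm ι R j)) * ∑ i, b i ^ (k - j) := by
  classical
  have h := congrArg (MvPolynomial.aeval b) (MvPolynomial.mul_esymm_eq_sum ι R k)
  rw [Finset.sum_filter, Finset.Nat.sum_antidiagonal_eq_sum_range_succ_mk,
    Finset.sum_range_succ, if_neg (lt_irrefl k), add_zero,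
    Finset.sum_congr rfl fun j hj => if_pos (Finset.mem_range.mp hj)] at h
  simp only [map_mul, map_natCast, map_pow, map_neg, map_one, map_sum, MvPolynomial.psum,
    MvPolynomial.aeval_X] at h
  have hs : ((-1 : R) ^ k) * (-1) ^ k = 1 := by rw [← mul_pow]; simp
  linear_combination (-1) ^ k * h - (∑ j ∈ Finset.range k,
        ((-1) ^ j * MvPolynomial.aeval b (MvPolynomial.esymm ι R j)) * ∑ i, b i ^ (k - j)) * hs

lemma prod_one_sub_C_mul_X {ι R : Type*} [Fintype ι] [CommRing R] (b : ι → R) :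
    ∏ j, (1 - C (b j) * X) = ∑ k ∈ Finset.range (Fintype.card ι + 1),
      C ((-1) ^ k * MvPolynomial.aeval b (MvPolynomial.esymm ι R k)) * X ^ k := by
  classical
  simp only [sub_eq_add_neg, Finset.prod_one_add, Finset.sum_powerset, Finset.card_univ]
  refine Finset.sum_congr rfl fun k _ => ?_
  simp only [MvPolynomial.esymm, map_sum, map_prod, MvPolynomial.aeval_X, Finset.mul_sum,
    Finset.sum_mul]
  refine Finset.sum_congr rfl fun t ht => ?_
  rw [Finset.prod_neg, Finset.prod_mul_distrib, Finset.prod_const,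
    (Finset.mem_powersetCard.mp ht).2]
  simp [mul_assoc]

theorem stmt_6 (q : ℝ) (hq : 1 < q) (n : ℕ) (hn : 1 ≤ n) (b : Fin n → ℂ)
    (hb : ∀ k : ℕ, 1 ≤ k → k ≤ n → ∑ j, b j ^ k = 1 / ((q : ℂ) ^ k - 1)) :
    ∏ j, (1 - Polynomial.C (b j) * Polynomial.X)
      = ∑ k ∈ Finset.range (n + 1),
          Polynomial.C (∏ i ∈ Finset.range k, (1 - (q : ℂ) ^ (i + 1)))⁻¹
            * Polynomial.X ^ k := by
  have hq' (k : ℕ) : 1 - (q : ℂ) ^ (k + 1) ≠ 0 := by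
    have := one_lt_pow₀ hq k.succ_ne_zero
    rw [sub_ne_zero]
    exact_mod_cast this.ne
  have key (k : ℕ) : k ≤ n →
      (-1) ^ k * MvPolynomial.aeval b (MvPolynomial.esymm (Fin n) ℂ k) = qExpCoeff (q : ℂ) k := by
    induction k using Nat.strong_induction_on with
    | _ k ih =>
      intro hk
      rcases Nat.eq_zero_or_pos k with rfl | hpos
      · simp [qExpCoeff_zero]
      refine mul_left_cancel₀ (Nat.cast_ne_zero.mpr hpos.ne' : (k : ℂ) ≠ 0) ?_
      rw [natCast_mul_signed_esymm, natCast_mul_qExpCoeff hq', ← Finset.sum_neg_distrib]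
      refine Finset.sum_congr rfl fun j hj => ?_
      have hjk := Finset.mem_range.mp hj
      rw [ih j hjk (by omega), hb (k - j) (by omega) (by omega), ← neg_sub 1 ((q : ℂ) ^ (k - j)),
        div_neg, mul_neg, neg_neg, mul_one_div]
  rw [prod_one_sub_C_mul_X, Fintype.card_fin]
  refine Finset.sum_congr rfl fun k hk => ?_
  rw [key k (Finset.mem_range_succ_iff.mp hk), qExpCoeff]
end

section
/- Let q > 1 be a real number and k ≥ 1 an integer. Then the sum over all strictly increasing k-tuples of positive integers j₁ < j₂ < ⋯ < j_k of the product q^{−j₁}q^{−j₂}⋯q^{−j_k} converges and equals 1/((q−1)(q²−1)⋯(q^k−1)). In other words, the k-th elementary symmetric function of the sequence (q^{−1}, q^{−2}, q^{−3}, …) equals ∏_{i=1}^k (q^i − 1)^{−1}. -/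
/-- The finite sets of positive integers with `k` elements are the shifts of the finite sets of
natural numbers with `k` elements. -/
lemma setOf_card_eq_and_pos_eq_image (k : ℕ) :
    {s : Finset ℕ | s.card = k ∧ ∀ i ∈ s, 0 < i} =
      Finset.map (addRightEmbedding 1) '' {s : Finset ℕ | s.card = k} := by
  ext s
  simp only [Set.mem_ofPred_eq, Set.mem_image]
  constructor
  · rintro ⟨hs, hpos⟩
    have himage : (s.image (· - 1)).map (addRightEmbedding 1) = s := by
      ext i
      simp only [Finset.mem_map, Finset.mem_image, addRightEmbedding_apply]
      constructor
      · rintro ⟨_, ⟨j, hj, rfl⟩, rfl⟩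
        rwa [Nat.sub_add_cancel (hpos j hj)]
      · intro hi
        exact ⟨i - 1, ⟨i, hi, rfl⟩, Nat.sub_add_cancel (hpos i hi)⟩
    refine ⟨s.image (· - 1), ?_, himage⟩
    rw [← hs, ← congrArg Finset.card himage, Finset.card_map]
  · rintro ⟨t, ht, rfl⟩
    simp [ht]

/-- A `k + 1`-element finite set of natural numbers either avoids `0` or arises by inserting `0`
into a `k`-element finite set of positive integers. -/
lemma setOf_card_eq_succ_eq_union (k : ℕ) :
    {s : Finset ℕ | s.card = k + 1} =
      {s : Finset ℕ | s.card = k + 1 ∧ ∀ i ∈ s, 0 < i} ∪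
        insert 0 '' {s : Finset ℕ | s.card = k ∧ ∀ i ∈ s, 0 < i} := by
  ext s
  simp only [Set.mem_ofPred_eq, Set.mem_union, Set.mem_image]
  constructor
  · intro hs
    by_cases h : 0 ∈ s
    · refine Or.inr ⟨s.erase 0, ⟨?_, ?_⟩, Finset.insert_erase h⟩
      · rw [Finset.card_erase_of_mem h, hs, Nat.add_sub_cancel]
      · intro i hi
        exact Nat.pos_of_ne_zero (Finset.ne_of_mem_erase hi)
    · exact Or.inl ⟨hs, fun i hi => Nat.pos_of_ne_zero fun h0 => h (h0 ▸ hi)⟩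
  · rintro (hs | ⟨t, ⟨ht, hpos⟩, rfl⟩)
    · exact hs.1
    · rw [Finset.card_insert_of_notMem fun h => (hpos 0 h).false, ht]

lemma summable_prod_inv_pow {q : ℝ} (hq : 1 < q) :
    Summable fun s : Finset ℕ => ∏ i ∈ s, (q ^ i)⁻¹ := by
  apply summable_finsetProd_of_summable_norm
  simpa [abs_of_pos (zero_lt_one.trans hq)] using
    summable_geometric_of_lt_one (inv_nonneg.2 (zero_le_one.trans hq.le)) (inv_lt_one_of_one_lt₀ hq)

lemma tsum_pos_eq_inv_pow_mul_tsum (q : ℝ) (k : ℕ) :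
    ∑' s : {s : Finset ℕ | s.card = k ∧ ∀ i ∈ s, 0 < i}, ∏ i ∈ (s : Finset ℕ), (q ^ i)⁻¹ =
      (q ^ k)⁻¹ * ∑' s : {s : Finset ℕ | s.card = k}, ∏ i ∈ (s : Finset ℕ), (q ^ i)⁻¹ := by
  rw [setOf_card_eq_and_pos_eq_image,
    tsum_image (fun s : Finset ℕ => ∏ i ∈ s, (q ^ i)⁻¹) (Finset.map_injective _).injOn,
    ← tsum_mul_left]
  refine tsum_congr fun s => ?_
  have hs : (s : Finset ℕ).card = k := s.2
  simp [Finset.prod_map, pow_succ, Finset.prod_mul_distrib, hs, mul_comm]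

lemma tsum_card_succ_eq_add {q : ℝ} (hq : 1 < q) (k : ℕ) :
    ∑' s : {s : Finset ℕ | s.card = k + 1}, ∏ i ∈ (s : Finset ℕ), (q ^ i)⁻¹ =
      ∑' s : {s : Finset ℕ | s.card = k + 1 ∧ ∀ i ∈ s, 0 < i},
          ∏ i ∈ (s : Finset ℕ), (q ^ i)⁻¹ +
        ∑' s : {s : Finset ℕ | s.card = k ∧ ∀ i ∈ s, 0 < i},
          ∏ i ∈ (s : Finset ℕ), (q ^ i)⁻¹ := by
  have hsum := summable_prod_inv_pow hq
  have hdisj : Disjoint {s : Finset ℕ | s.card = k + 1 ∧ ∀ i ∈ s, 0 < i}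
      (insert 0 '' {s : Finset ℕ | s.card = k ∧ ∀ i ∈ s, 0 < i}) := by
    rw [Set.disjoint_left]
    rintro _ ⟨-, hpos⟩ ⟨t, -, rfl⟩
    exact (hpos 0 (Finset.mem_insert_self 0 t)).false
  have hinj : Set.InjOn (insert 0) {s : Finset ℕ | s.card = k ∧ ∀ i ∈ s, 0 < i} := by
    intro s hs t ht hst
    rw [← Finset.erase_insert fun h => (hs.2 0 h).false, hst,
      Finset.erase_insert fun h => (ht.2 0 h).false]
  rw [setOf_card_eq_succ_eq_union,
    Summable.tsum_union_disjoint (f := fun s : Finset ℕ => ∏ i ∈ s, (q ^ i)⁻¹) hdisj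
      (hsum.subtype _) (hsum.subtype _),
    tsum_image (fun s : Finset ℕ => ∏ i ∈ s, (q ^ i)⁻¹) hinj]
  congr 1
  refine tsum_congr fun s => ?_
  rw [Finset.prod_insert fun h => (s.2.2 0 h).false]
  simp

lemma tsum_pos_eq_prod {q : ℝ} (hq : 1 < q) (k : ℕ) :
    ∑' s : {s : Finset ℕ | s.card = k ∧ ∀ i ∈ s, 0 < i}, ∏ i ∈ (s : Finset ℕ), (q ^ i)⁻¹ =
      ∏ i ∈ Finset.range k, (q ^ (i + 1) - 1)⁻¹ := by
  induction k with
  | zero =>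
    have h : {s : Finset ℕ | s.card = 0 ∧ ∀ i ∈ s, 0 < i} = {∅} := by
      ext s
      simp +contextual [Finset.card_eq_zero]
    rw [h, tsum_singleton (∅ : Finset ℕ) fun s : Finset ℕ => ∏ i ∈ s, (q ^ i)⁻¹]
    simp
  | succ k ih =>
    have hshift := tsum_pos_eq_inv_pow_mul_tsum q (k + 1)
    rw [tsum_card_succ_eq_add hq, ih] at hshift
    have hpow : 1 < q ^ (k + 1) := one_lt_pow₀ hq k.succ_ne_zero
    rw [Finset.prod_range_succ, eq_mul_inv_iff_mul_eq₀ (sub_pos.2 hpow).ne']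
    rw [eq_inv_mul_iff_mul_eq₀ (zero_lt_one.trans hpow).ne'] at hshift
    linear_combination hshift

theorem stmt_7 (q : ℝ) (hq : 1 < q) (k : ℕ) (hk : 1 ≤ k) :
    HasSum
      (fun s : {s : Finset ℕ // s.card = k ∧ ∀ i ∈ s, 0 < i} =>
        ∏ i ∈ (s : Finset ℕ), (q ^ i)⁻¹)
      (∏ i ∈ Finset.range k, (q ^ (i + 1) - 1)⁻¹) := by
  rw [← tsum_pos_eq_prod hq k]
  exact ((summable_prod_inv_pow hq).subtype
    {s : Finset ℕ | s.card = k ∧ ∀ i ∈ s, 0 < i}).hasSum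
end

section
/- Let q > 1 be a real number. Then for every x ∈ ℝ (or ℂ), the series ∑_{k=0}^∞ x^k/(q;q)_k converges absolutely, the infinite product ∏_{j=1}^∞ (1 − q^{−j}x) converges, and ∑_{k=0}^∞ x^k/(q;q)_k = ∏_{j=1}^∞ (1 − q^{−j}x); i.e., the function F_q(x) = ∑_{k=0}^∞ x^k/(q;q)_k is entire with zero set exactly {q, q², q³, …}. -/
/-- The `q`-Pochhammer symbol `(q;q)_k = ∏_{j=1}^k (1 - q^j)`. -/
def poch (q : ℝ) (k : ℕ) : ℝ := ∏ j ∈ Finset.range k, (1 - q ^ (j + 1))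

open Filter Topology

lemma poch_succ (q : ℝ) (k : ℕ) : poch q (k + 1) = poch q k * (1 - q ^ (k + 1)) :=
  Finset.prod_range_succ _ _

lemma one_sub_pow_succ_ne_zero {q : ℝ} (hq : 1 < q) (k : ℕ) : 1 - q ^ (k + 1) ≠ 0 :=
  (sub_neg.2 (one_lt_pow₀ hq k.succ_ne_zero)).ne

lemma poch_ne_zero {q : ℝ} (hq : 1 < q) (k : ℕ) : poch q k ≠ 0 :=
  Finset.prod_ne_zero_iff.2 fun j _ => one_sub_pow_succ_ne_zero hq j

lemma summable_pow_div_poch {q : ℝ} (hq : 1 < q) (x : ℝ) :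
    Summable fun k : ℕ => x ^ k / poch q k := by
  have hlim : Tendsto (fun k : ℕ => q ^ (k + 1)) atTop atTop :=
    (tendsto_pow_atTop_atTop_of_one_lt hq).comp (tendsto_add_atTop_nat 1)
  refine summable_of_ratio_norm_eventually_le (r := 1 / 2) (by norm_num) ?_
  filter_upwards [hlim.eventually_ge_atTop (1 + 2 * |x|)] with k hk
  have hpos : 0 < q ^ (k + 1) - 1 := sub_pos.2 (one_lt_pow₀ hq k.succ_ne_zero)
  have hratio : x ^ (k + 1) / poch q (k + 1) = x / (1 - q ^ (k + 1)) * (x ^ k / poch q k) := by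
    rw [poch_succ, pow_succ, mul_comm (poch q k), mul_comm (x ^ k), mul_div_mul_comm]
  rw [hratio, norm_mul]
  refine mul_le_mul_of_nonneg_right ?_ (norm_nonneg _)
  rw [norm_div, Real.norm_eq_abs, Real.norm_eq_abs, abs_sub_comm, abs_of_pos hpos,
    div_le_iff₀ hpos]
  linarith

/-- The functional equation `F_q(qx) = (1 - x) F_q(x)`. -/
lemma tsum_mul_pow_div_poch {q : ℝ} (hq : 1 < q) (x : ℝ) :
    ∑' k : ℕ, (q * x) ^ k / poch q k = (1 - x) * ∑' k : ℕ, x ^ k / poch q k := by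
  have hx := summable_pow_div_poch hq x
  have hqx := summable_pow_div_poch hq (q * x)
  have hterm (k : ℕ) : (q * x) ^ (k + 1) / poch q (k + 1) =
      x ^ (k + 1) / poch q (k + 1) - x * (x ^ k / poch q k) := by
    have h₁ := one_sub_pow_succ_ne_zero hq k
    have h₂ := poch_ne_zero hq k
    rw [poch_succ]
    field_simp
    ring
  rw [hqx.tsum_eq_zero_add, tsum_congr hterm,
    ((summable_nat_add_iff 1).2 hx).tsum_sub (hx.mul_left x), tsum_mul_left, sub_mul, one_mul,
    hx.tsum_eq_zero_add]
  simp only [pow_zero]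
  ring

lemma tsum_pow_div_poch_eq_prod_mul {q : ℝ} (hq : 1 < q) (x : ℝ) (n : ℕ) :
    ∑' k : ℕ, x ^ k / poch q k = (∏ j ∈ Finset.range n, (1 - (q ^ (j + 1))⁻¹ * x)) *
      ∑' k : ℕ, ((q ^ n)⁻¹ * x) ^ k / poch q k := by
  induction n with
  | zero => simp
  | succ n ih =>
    have hq₀ : q ≠ 0 := by positivity
    have hstep : (q ^ n)⁻¹ * x = q * ((q ^ (n + 1))⁻¹ * x) := by
      field_simp
      ring
    rw [ih, hstep, tsum_mul_pow_div_poch hq, Finset.prod_range_succ, mul_assoc]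

lemma tendsto_inv_pow_mul {q : ℝ} (hq : 1 < q) (x : ℝ) :
    Tendsto (fun n : ℕ => (q ^ n)⁻¹ * x) atTop (𝓝 0) := by
  simpa using (tendsto_pow_atTop_atTop_of_one_lt hq).inv_tendsto_atTop.mul_const x

lemma tendsto_tsum_inv_pow_mul {q : ℝ} (hq : 1 < q) (x : ℝ) :
    Tendsto (fun n : ℕ => ∑' k : ℕ, ((q ^ n)⁻¹ * x) ^ k / poch q k) atTop (𝓝 1) := by
  have hzero : ∑' k : ℕ, (0 : ℝ) ^ k / poch q k = 1 := by
    rw [tsum_eq_single 0 fun k hk => by simp [hk]]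
    simp [poch]
  rw [← hzero]
  refine tendsto_tsum_of_dominated_convergence (summable_pow_div_poch hq x).norm
    (fun k => ((tendsto_inv_pow_mul hq x).pow k).div_const _) (.of_forall fun n k => ?_)
  rw [norm_div, norm_div, norm_pow, norm_pow, norm_mul]
  gcongr
  refine mul_le_of_le_one_left (norm_nonneg x) ?_
  rw [norm_inv, norm_pow, Real.norm_of_nonneg (by positivity)]
  exact inv_le_one_of_one_le₀ (one_le_pow₀ hq.le)

lemma summable_norm_neg_inv_pow_mul {q : ℝ} (hq : 1 < q) (x : ℝ) :
    Summable fun j : ℕ => ‖-((q ^ (j + 1))⁻¹ * x)‖ := by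
  have hgeom : Summable fun j : ℕ => q⁻¹ ^ j :=
    summable_geometric_of_lt_one (by positivity) (inv_lt_one_of_one_lt₀ hq)
  simpa only [inv_pow] using (((summable_nat_add_iff 1).2 hgeom).mul_right x).neg.norm

lemma multipliable_one_sub_inv_pow_mul {q : ℝ} (hq : 1 < q) (x : ℝ) :
    Multipliable fun j : ℕ => 1 - (q ^ (j + 1))⁻¹ * x := by
  simpa only [sub_eq_add_neg] using
    multipliable_one_add_of_summable (summable_norm_neg_inv_pow_mul hq x)

lemma tsum_pow_div_poch_eq_tprod {q : ℝ} (hq : 1 < q) (x : ℝ) :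
    ∑' k : ℕ, x ^ k / poch q k = ∏' j : ℕ, (1 - (q ^ (j + 1))⁻¹ * x) := by
  have hlim := (multipliable_one_sub_inv_pow_mul hq x).hasProd.tendsto_prod_nat.mul
    (tendsto_tsum_inv_pow_mul hq x)
  simp only [← tsum_pow_div_poch_eq_prod_mul hq, mul_one] at hlim
  exact tendsto_nhds_unique tendsto_const_nhds hlim

lemma tprod_one_sub_inv_pow_mul_eq_zero_iff {q : ℝ} (hq : 1 < q) (x : ℝ) :
    ∏' j : ℕ, (1 - (q ^ (j + 1))⁻¹ * x) = 0 ↔ ∃ j : ℕ, x = q ^ (j + 1) := by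
  have hfactor (j : ℕ) : 1 - (q ^ (j + 1))⁻¹ * x = 0 ↔ x = q ^ (j + 1) := by
    have hne : q ^ (j + 1) ≠ 0 := by positivity
    rw [sub_eq_zero, eq_comm, inv_mul_eq_one₀ hne, eq_comm]
  refine ⟨fun h => ?_, fun ⟨j, hj⟩ => tprod_of_exists_eq_zero ⟨j, (hfactor j).2 hj⟩⟩
  by_contra! hx
  refine tprod_one_add_ne_zero_of_summable (f := fun j : ℕ => -((q ^ (j + 1))⁻¹ * x))
    (fun j => ?_) (summable_norm_neg_inv_pow_mul hq x) ?_
  · simpa only [← sub_eq_add_neg] using (hfactor j).not.2 (hx j)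
  · simpa only [← sub_eq_add_neg] using h

theorem stmt_8 (q : ℝ) (hq : 1 < q) (x : ℝ) :
    Summable (fun k : ℕ => |x ^ k / poch q k|) ∧
    Multipliable (fun j : ℕ => 1 - (q ^ (j + 1))⁻¹ * x) ∧
    (∑' k : ℕ, x ^ k / poch q k) = (∏' j : ℕ, (1 - (q ^ (j + 1))⁻¹ * x)) ∧
    ((∑' k : ℕ, x ^ k / poch q k) = 0 ↔ ∃ j : ℕ, x = q ^ (j + 1)) := by
  refine ⟨(summable_pow_div_poch hq x).abs, multipliable_one_sub_inv_pow_mul hq x,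
    tsum_pow_div_poch_eq_tprod hq x, ?_⟩
  rw [tsum_pow_div_poch_eq_tprod hq x]
  exact tprod_one_sub_inv_pow_mul_eq_zero_iff hq x
end

section
/- Let q ≥ 4 be a real number and n ≥ 1 an integer. Then the polynomial F_{q,≤n}(x) = ∑_{k=0}^n x^k/(q;q)_k has n distinct, strictly positive real roots. -/
/-- An alternating sum of an antitone nonnegative sequence lies between `0` and its first term. -/
theorem alternating_sum_antitone (m : ℕ) (T : ℕ → ℝ) (h0 : ∀ i, 0 ≤ T i)
    (hT : ∀ i, T (i + 1) ≤ T i) :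
    0 ≤ ∑ i ∈ Finset.range m, (-1) ^ i * T i ∧ ∑ i ∈ Finset.range m, (-1) ^ i * T i ≤ T 0 := by
  induction m generalizing T with
  | zero => simpa using h0 0
  | succ m ih =>
    obtain ⟨h1, h2⟩ := ih (fun i => T (i + 1)) (fun i => h0 _) (fun i => hT _)
    have h : ∑ i ∈ Finset.range (m + 1), (-1) ^ i * T i
        = T 0 - ∑ i ∈ Finset.range m, (-1) ^ i * T (i + 1) := by
      rw [Finset.sum_range_succ', sub_eq_add_neg, ← Finset.sum_neg_distrib, add_comm]
      simp [pow_succ]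
    have h3 : T (0 + 1) ≤ T 0 := hT 0
    rw [h]
    constructor <;> linarith

/-- An alternating sum of a nonnegative sequence that increases up to its last term has the sign
of that term and is bounded by it. -/
theorem alternating_sum_monotone (k : ℕ) (T : ℕ → ℝ) (h0 : ∀ i, 0 ≤ T i)
    (hT : ∀ i < k, T i ≤ T (i + 1)) :
    0 ≤ (-1) ^ k * ∑ i ∈ Finset.range (k + 1), (-1) ^ i * T i ∧
      (-1) ^ k * ∑ i ∈ Finset.range (k + 1), (-1) ^ i * T i ≤ T k := by
  induction k with
  | zero => simpa using h0 0
  | succ k ih =>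
    obtain ⟨h1, h2⟩ := ih fun i hi => hT i (by omega)
    have h3 := hT k (by omega)
    have h4 : ((-1 : ℝ) ^ k) * (-1) ^ k = 1 := by rw [← mul_pow]; simp
    have h : (-1 : ℝ) ^ (k + 1) * ∑ i ∈ Finset.range (k + 1 + 1), (-1) ^ i * T i
        = T (k + 1) - (-1) ^ k * ∑ i ∈ Finset.range (k + 1), (-1) ^ i * T i := by
      rw [Finset.sum_range_succ _ (k + 1), pow_succ]
      linear_combination T (k + 1) * h4
    rw [h]
    constructor <;> linarith

/-- If the `k`-th term dominates the sum of its two neighbours, and the terms increase before it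
and decrease after it, then the alternating sum has the sign of the `k`-th term. -/
theorem alternating_sum_pos_of_dominant {k n : ℕ} (hk : k ≤ n) (T : ℕ → ℝ) (h0 : ∀ i, 0 < T i)
    (hinc : ∀ i < k, 2 * T i < T (i + 1)) (hmid : 2 * T (k + 1) ≤ T k)
    (hdec : ∀ i, k < i → T (i + 1) ≤ T i) :
    0 < (-1) ^ k * ∑ i ∈ Finset.range (n + 1), (-1) ^ i * T i := by
  obtain ⟨m, rfl⟩ := Nat.exists_eq_add_of_le hk
  have h4 : ((-1 : ℝ) ^ k) * (-1) ^ k = 1 := by rw [← mul_pow]; simp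
  have hlow : T k < 2 * ((-1) ^ k * ∑ i ∈ Finset.range (k + 1), (-1) ^ i * T i) := by
    cases k with
    | zero => simpa using by linarith [h0 0]
    | succ k =>
      have h1 := (alternating_sum_monotone k T (fun i => (h0 i).le) fun i hi => by
        linarith [hinc i (by omega), h0 i]).2
      have h2 := hinc k (by omega)
      have h : (-1 : ℝ) ^ (k + 1) * ∑ i ∈ Finset.range (k + 1 + 1), (-1) ^ i * T i
          = T (k + 1) - (-1) ^ k * ∑ i ∈ Finset.range (k + 1), (-1) ^ i * T i := by
        rw [Finset.sum_range_succ _ (k + 1)]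
        simp only [pow_succ] at h4 ⊢
        linear_combination T (k + 1) * h4
      rw [h]
      linarith
  have hup := (alternating_sum_antitone m (fun i => T (k + 1 + i)) (fun i => (h0 _).le)
    fun i => hdec (k + 1 + i) (by omega)).2
  have h : (-1 : ℝ) ^ k * ∑ i ∈ Finset.range (k + m + 1), (-1) ^ i * T i
      = (-1) ^ k * ∑ i ∈ Finset.range (k + 1), (-1) ^ i * T i
        - ∑ i ∈ Finset.range m, (-1) ^ i * T (k + 1 + i) := by
    rw [show k + m + 1 = k + 1 + m by ring, Finset.sum_range_add, mul_add, sub_eq_add_neg,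
      ← Finset.sum_neg_distrib, Finset.mul_sum _ _ ((-1 : ℝ) ^ k)]
    rw [Finset.mul_sum]
    congr 1
    refine Finset.sum_congr rfl fun i _ => ?_
    rw [pow_add, pow_succ]
    linear_combination -((-1) ^ i * T (k + 1 + i)) * h4
  simp only [add_zero] at hup
  rw [h]
  linarith

/-- The truncated series has sign `(-1)^k` at the point `(q^(k+1) - 1) / 2`. -/
theorem truncation_sign {q : ℝ} (hq : 4 ≤ q) {k n : ℕ} (hk : k ≤ n) :
    0 < (-1) ^ k * ∑ i ∈ Finset.range (n + 1), ((q ^ (k + 1) - 1) / 2) ^ i / poch q i := by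
  have hq1 : 1 < q := by linarith
  have hpos : ∀ j : ℕ, 0 < q ^ (j + 1) - 1 := fun j =>
    sub_pos.2 (one_lt_pow₀ hq1 j.succ_ne_zero)
  have hmono : ∀ {i j : ℕ}, i ≤ j → q ^ i ≤ q ^ j := fun h => pow_le_pow_right₀ hq1.le h
  set x := (q ^ (k + 1) - 1) / 2 with hx
  have hx0 : 0 < x := half_pos (hpos k)
  set T : ℕ → ℝ := fun i => x ^ i / ∏ j ∈ Finset.range i, (q ^ (j + 1) - 1) with hTdef
  have h0 : ∀ i, 0 < T i := fun i =>
    div_pos (pow_pos hx0 i) (Finset.prod_pos fun j _ => hpos j)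
  have hrec : ∀ i, T (i + 1) * (q ^ (i + 1) - 1) = x * T i := fun i => by
    have h1 := (hpos i).ne'
    have h2 : ∏ j ∈ Finset.range i, (q ^ (j + 1) - 1) ≠ 0 :=
      (Finset.prod_pos fun j _ => hpos j).ne'
    simp only [hTdef, Finset.prod_range_succ]
    field_simp
    exact pow_succ' x i
  have hterm : ∀ i, x ^ i / poch q i = (-1) ^ i * T i := fun i => by
    have h : poch q i = (-1) ^ i * ∏ j ∈ Finset.range i, (q ^ (j + 1) - 1) := by
      rw [poch, ← Finset.card_range i, ← Finset.prod_const, Finset.card_range,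
        ← Finset.prod_mul_distrib]
      exact Finset.prod_congr rfl fun j _ => by ring
    rcases neg_one_pow_eq_or ℝ i with h1 | h1 <;> simp [h, h1, hTdef, div_neg]
  simp only [hterm]
  refine alternating_sum_pos_of_dominant hk T h0 (fun i hi => ?_) ?_ fun i hi => ?_
  · have h1 : 2 * (q ^ (i + 1) - 1) < x := by
      have h2 : q ^ (i + 2) ≤ q ^ (k + 1) := hmono (by omega)
      have h3 : 4 * q ^ (i + 1) ≤ q ^ (i + 2) := by
        rw [pow_succ q (i + 1), mul_comm]
        exact mul_le_mul_of_nonneg_left hq (by positivity)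
      rw [hx]; linarith
    refine lt_of_mul_lt_mul_right ?_ (hpos i).le
    rw [hrec]
    nlinarith [h0 i]
  · refine le_of_mul_le_mul_right ?_ (hpos k)
    rw [mul_assoc, hrec, hx]
    linarith
  · refine le_of_mul_le_mul_right ?_ (hpos i)
    rw [hrec, mul_comm]
    refine mul_le_mul_of_nonneg_left ?_ (h0 i).le
    have h2 : q ^ (k + 1) ≤ q ^ (i + 1) := hmono (by omega)
    have h3 := hpos k
    rw [hx]; linarith

/-- The truncated series `F_{q,≤n}(x) = ∑_{k=0}^n x^k/(q;q)_k` has `n` distinct,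
strictly positive real roots. -/
theorem stmt_9 (q : ℝ) (hq : 4 ≤ q) (n : ℕ) (hn : 1 ≤ n) :
    ∃ r : Fin n → ℝ, StrictMono r ∧
      ∀ i, 0 < r i ∧ ∑ k ∈ Finset.range (n + 1), (r i) ^ k / poch q k = 0 := by
  have hq1 : 1 < q := by linarith
  set X : ℕ → ℝ := fun k => (q ^ (k + 1) - 1) / 2 with hX
  have hXmono : Monotone X := fun i j h => by
    have := pow_le_pow_right₀ hq1.le (Nat.succ_le_succ h)
    simp only [hX, Nat.succ_eq_add_one] at this ⊢
    linarith
  have hX0 : ∀ k, 0 < X k := fun k =>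
    half_pos (sub_pos.2 (one_lt_pow₀ hq1 k.succ_ne_zero))
  have hroot : ∀ i : Fin n, ∃ r ∈ Set.Ioo (X i) (X (i + 1)),
      ∑ k ∈ Finset.range (n + 1), r ^ k / poch q k = 0 := fun i => by
    have h1 := truncation_sign hq (k := i) (n := n) (by omega)
    have h2 := truncation_sign hq (k := i + 1) (n := n) (by omega)
    have hcont : Continuous fun r : ℝ =>
        (-1) ^ (i : ℕ) * ∑ k ∈ Finset.range (n + 1), r ^ k / poch q k := by fun_prop
    rw [pow_succ, mul_neg_one, neg_mul, neg_pos] at h2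
    obtain ⟨r, hr, h⟩ := intermediate_value_Ioo' (hXmono (Nat.le_succ i)) hcont.continuousOn
      ⟨h2, h1⟩
    exact ⟨r, hr, (mul_eq_zero.1 h).resolve_left (by simp)⟩
  choose r hr hr0 using hroot
  refine ⟨r, fun i j hij => ?_, fun i => ⟨(hX0 i).trans (hr i).1, hr0 i⟩⟩
  exact ((hr i).2.trans_le (hXmono (Nat.succ_le_of_lt hij))).trans (hr j).1
end

section
/- Let q ≥ 4 be a real number, n ≥ 1 an integer, and 0 ≤ k ≤ n an integer. Then (−1)^k F_{q,≤n}(q^{k+1/2}) > 0; that is, the value of the truncated series F_{q,≤n} at the points q^{1/2}, q^{3/2}, …, q^{n+1/2} alternates in sign, starting positive. -/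
theorem alternating_sum_antitone_bounds (N : ℕ) (c : ℕ → ℝ) (hc : Antitone c)
    (h0 : ∀ i, 0 ≤ c i) :
    0 ≤ ∑ i ∈ Finset.range N, (-1 : ℝ) ^ i * c i ∧
      ∑ i ∈ Finset.range N, (-1 : ℝ) ^ i * c i ≤ c 0 := by
  induction N generalizing c with
  | zero => simpa using h0 0
  | succ N ih =>
    obtain ⟨h1, h2⟩ := ih (fun i => c (i + 1)) (fun a b hab => hc (by omega)) (fun i => h0 _)
    have h3 : c (0 + 1) ≤ c 0 := hc (by omega)
    have h4 : ∑ i ∈ Finset.range N, (-1 : ℝ) ^ (i + 1) * c (i + 1)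
        = -∑ i ∈ Finset.range N, (-1 : ℝ) ^ i * c (i + 1) := by
      rw [← Finset.sum_neg_distrib]
      exact Finset.sum_congr rfl fun i _ => by ring
    rw [Finset.sum_range_succ', h4]
    constructor <;> simp only [pow_zero, one_mul] <;> linarith

theorem sub_le_alternating_sum_of_antitone (N : ℕ) (c : ℕ → ℝ) (hc : Antitone c)
    (h0 : ∀ i, 0 ≤ c i) :
    c 0 - c 1 ≤ ∑ i ∈ Finset.range (N + 1), (-1 : ℝ) ^ i * c i := by
  have h2 := (alternating_sum_antitone_bounds N (fun i => c (i + 1))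
    (fun a b hab => hc (by omega)) (fun i => h0 _)).2
  have h4 : ∑ i ∈ Finset.range N, (-1 : ℝ) ^ (i + 1) * c (i + 1)
      = -∑ i ∈ Finset.range N, (-1 : ℝ) ^ i * c (i + 1) := by
    rw [← Finset.sum_neg_distrib]
    exact Finset.sum_congr rfl fun i _ => by ring
  rw [Finset.sum_range_succ', h4]
  simp only [pow_zero, one_mul, zero_add] at h2 ⊢
  linarith

theorem alternating_sum_monotone_bounds (b : ℕ → ℝ) (h0 : ∀ i, 0 ≤ b i) (j : ℕ)
    (hb : ∀ i < j, b i ≤ b (i + 1)) :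
    0 ≤ (-1 : ℝ) ^ j * ∑ i ∈ Finset.range (j + 1), (-1 : ℝ) ^ i * b i ∧
      (-1 : ℝ) ^ j * ∑ i ∈ Finset.range (j + 1), (-1 : ℝ) ^ i * b i ≤ b j := by
  induction j with
  | zero => simpa using h0 0
  | succ j ih =>
    obtain ⟨h1, h2⟩ := ih fun i hi => hb i (by omega)
    have h3 := hb j (by omega)
    have h4 : (-1 : ℝ) ^ (j + 1) * ∑ i ∈ Finset.range (j + 1 + 1), (-1 : ℝ) ^ i * b i
        = b (j + 1) - (-1 : ℝ) ^ j * ∑ i ∈ Finset.range (j + 1), (-1 : ℝ) ^ i * b i := by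
      rw [Finset.sum_range_succ, mul_add, ← mul_assoc, ← mul_pow]
      norm_num
      ring
    rw [h4]
    constructor <;> linarith

/-- A unimodal alternating sum takes the sign of its dominant term. -/
theorem alternating_sum_pos_of_unimodal (b : ℕ → ℝ) (h0 : ∀ i, 0 ≤ b i) (k n : ℕ) (hk : k ≤ n)
    (hinc : ∀ i < k, b i ≤ b (i + 1)) (hdec : ∀ i, k ≤ i → b (i + 1) ≤ b i)
    (hzero : k = 0 → b 1 < b 0) (hsucc : ∀ j, k = j + 1 → b j + b (j + 2) < b (j + 1)) :
    0 < (-1 : ℝ) ^ k * ∑ m ∈ Finset.range (n + 1), (-1 : ℝ) ^ m * b m := by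
  obtain ⟨N, rfl⟩ := Nat.exists_eq_add_of_le hk
  have hup := sub_le_alternating_sum_of_antitone N (fun i => b (k + i))
    (antitone_nat_of_succ_le fun i => hdec (k + i) (by omega)) (fun i => h0 _)
  have hsplit : (-1 : ℝ) ^ k * ∑ m ∈ Finset.range (k + N + 1), (-1 : ℝ) ^ m * b m
      = (-1 : ℝ) ^ k * ∑ m ∈ Finset.range k, (-1 : ℝ) ^ m * b m
        + ∑ i ∈ Finset.range (N + 1), (-1 : ℝ) ^ i * b (k + i) := by
    rw [add_assoc, Finset.sum_range_add, mul_add, Finset.mul_sum (Finset.range (N + 1))]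
    congr 1
    refine Finset.sum_congr rfl fun i _ => ?_
    rw [pow_add, ← mul_assoc, ← mul_assoc, ← mul_pow]
    norm_num
  rw [hsplit]
  rcases k with _ | j
  · have := hzero rfl
    simp only [Finset.range_zero, Finset.sum_empty, mul_zero, zero_add] at hup ⊢
    linarith
  · have h1 := hsucc j rfl
    have h2 := (alternating_sum_monotone_bounds b h0 j fun i hi => hinc i (by omega)).2
    rw [pow_succ]
    simp only [add_zero] at hup
    have h3 : b (j + 1 + 1) = b (j + 2) := rfl
    linarith

theorem poch_eq_neg_one_pow_mul_prod (q : ℝ) (m : ℕ) :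
    poch q m = (-1) ^ m * ∏ j ∈ Finset.range m, (q ^ (j + 1) - 1) := by
  induction m with
  | zero => simp [poch]
  | succ m ih =>
    unfold poch at ih ⊢
    rw [Finset.prod_range_succ, Finset.prod_range_succ, ih]
    ring

theorem stmt_10 (q : ℝ) (hq : 4 ≤ q) (n : ℕ) (hn : 1 ≤ n) (k : ℕ) (hk : k ≤ n) :
    0 < (-1 : ℝ) ^ k *
      ∑ m ∈ Finset.range (n + 1), (q ^ ((k : ℝ) + 1 / 2)) ^ m / poch q m := by
  have hq0 : 0 < q := by linarith
  obtain ⟨s, hs2, rfl⟩ : ∃ s : ℝ, 2 ≤ s ∧ q = s ^ 2 :=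
    ⟨√q, Real.le_sqrt_of_sq_le (by linarith), (Real.sq_sqrt hq0.le).symm⟩
  have hx : (s ^ 2) ^ ((k : ℝ) + 1 / 2) = s * (s ^ 2) ^ k := by
    rw [Real.rpow_add hq0, Real.rpow_natCast, ← Real.sqrt_eq_rpow, Real.sqrt_sq (by linarith),
      mul_comm]
  rw [hx]
  set q := s ^ 2 with hqs
  have hone : ∀ m, 4 ≤ q ^ (m + 1) := fun m =>
    hq.trans (le_self_pow₀ (by linarith) (by omega))
  have hqk : 1 ≤ q ^ k := one_le_pow₀ (by linarith)
  set x := s * q ^ k with hxdef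
  have hx0 : 0 < x := by positivity
  let b : ℕ → ℝ := fun m => x ^ m / ∏ j ∈ Finset.range m, (q ^ (j + 1) - 1)
  have hprod : ∀ m, 0 < ∏ j ∈ Finset.range m, (q ^ (j + 1) - 1) := fun m =>
    Finset.prod_pos fun j _ => by linarith [hone j]
  have hb : ∀ m, 0 < b m := fun m => div_pos (pow_pos hx0 m) (hprod m)
  have hrec : ∀ m, b (m + 1) * (q ^ (m + 1) - 1) = x * b m := by
    intro m
    have h1 := (hprod m).ne'
    have h2 : q ^ (m + 1) - 1 ≠ 0 := by linarith [hone m]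
    simp only [b, Finset.prod_range_succ]
    field_simp
    ring
  have hsum : ∑ m ∈ Finset.range (n + 1), x ^ m / poch q m
      = ∑ m ∈ Finset.range (n + 1), (-1 : ℝ) ^ m * b m := by
    refine Finset.sum_congr rfl fun m _ => ?_
    rw [poch_eq_neg_one_pow_mul_prod, div_mul_eq_div_div_swap, div_eq_mul_inv _ ((-1 : ℝ) ^ m),
      ← inv_pow, inv_neg_one, mul_comm]
  have hle_sub : x ≤ q ^ (k + 1) - 1 := by
    rw [pow_succ, hxdef]
    nlinarith
  rw [hsum]
  refine alternating_sum_pos_of_unimodal b (fun i => (hb i).le) k n hk ?_ ?_ ?_ ?_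
  · intro i hi
    have h1 : q ^ (i + 1) ≤ q ^ k := pow_le_pow_right₀ (by linarith) hi
    have h2 : q ^ (i + 1) - 1 ≤ x := by nlinarith
    have h3 := hone i
    by_contra! h
    nlinarith [hrec i, hb i, hb (i + 1)]
  · intro i hi
    have h1 : q ^ (k + 1) ≤ q ^ (i + 1) := pow_le_pow_right₀ (by linarith) (by omega)
    by_contra! h
    nlinarith [hrec i, hb i, hb (i + 1)]
  · rintro rfl
    have h := hrec 0
    have hxs : x = s := by simp [hxdef]
    rw [hxs] at h
    norm_num at h
    have h5 : s < q - 1 := by nlinarith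
    by_contra! h'
    nlinarith [hb 0, hb 1]
  · rintro j rfl
    have h1 := hrec j
    have h2 := hrec (j + 1)
    have hQ := hone j
    have hp : q ^ (j + 1 + 1) = s ^ 2 * q ^ (j + 1) := by rw [pow_succ, mul_comm]
    rw [hp] at h2
    set Q := q ^ (j + 1) with hQdef
    have hd : 0 < s ^ 2 * Q - 1 := by nlinarith
    have e1 : b j = b (j + 1) * ((Q - 1) / x) := by
      field_simp
      linarith
    have e2 : b (j + 2) = b (j + 1) * (x / (s ^ 2 * Q - 1)) := by
      field_simp
      linarith
    have key : (Q - 1) / x + x / (s ^ 2 * Q - 1) < 1 := by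
      rw [div_add_div _ _ hx0.ne' hd.ne', div_lt_one (by positivity), hxdef]
      have p1 : 0 ≤ s ^ 2 * Q ^ 2 * (s - 2) := mul_nonneg (by positivity) (by linarith)
      have p2 : 0 ≤ s * Q * (s - 1) := mul_nonneg (by positivity) (by linarith)
      nlinarith
    rw [e1, e2, ← mul_add]
    exact mul_lt_of_lt_one_right (hb _) key
end
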